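/- arXiv:2011.03576 — 2 statements merged into one kernel-verified Lean document; each statement's English description precedes it below -/
import Mathlib

section
/- Let Γ be a finite simplicial graph, x a vertex, and C_0, C_1, …, C_r the x-components. For each vertex y with y ≤ x and y not equivalent to x, and each y-component D, the set D ∖ st(x) is a union of x-components; let w_D ∈ ℚ^r be the vector whose i-th coordinate (1 ≤ i ≤ r) is 1 if C_i ⊆ D and 0 otherwise. Let Δ ⊆ ℚ^r be the set consisting of the vectors w_D for all such pairs (y,D) with C_0 ⊄ D, together with the vectors (1,1,…,1) − w_D for all such pairs (y,D) with C_0 ⊆ D. Then (1,1,…,1) lies in the ℚ-linear span of Δ if and only if π^x_{C_0} is virtually obtained from dominated non-equivalent components. -/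
open SimpleGraph

namespace RaagPaper

/-- The star of a vertex: the vertex together with its neighbours. -/
def star {V : Type} (G : SimpleGraph V) (v : V) : Set V := insert v (G.neighborSet v)

/-- Domination: `u ≤ v` iff `lk(u) ⊆ st(v)`. -/
def Dom {V : Type} (G : SimpleGraph V) (u v : V) : Prop := G.neighborSet u ⊆ star G v

/-- Domination-equivalence of vertices. -/
def EquivDom {V : Type} (G : SimpleGraph V) (u v : V) : Prop := Dom G u v ∧ Dom G v u

/-- The domination-equivalence class of a vertex. -/
def eqClass {V : Type} (G : SimpleGraph V) (x : V) : Set V := {v | EquivDom G v x}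

/-- `C` is (the vertex set of) a connected component of the subgraph of `G` induced on `S`. -/
def IsCC {V : Type} (G : SimpleGraph V) (S : Set V) (C : Set V) : Prop :=
  ∃ v : S, C = {w : V | ∃ h : w ∈ S, (G.induce S).Reachable ⟨w, h⟩ v}

/-- `(x,y|z)` is a separating intersection of links (SIL). -/
def IsSIL {V : Type} (G : SimpleGraph V) (x y z : V) : Prop :=
  x ≠ y ∧ x ≠ z ∧ y ≠ z ∧ ¬ G.Adj x y ∧ ¬ G.Adj x z ∧ ¬ G.Adj y z ∧
  ∀ C : Set V, IsCC G ((G.neighborSet x ∩ G.neighborSet y)ᶜ) C → z ∈ C → x ∉ C ∧ y ∉ C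

/-- The graph has no SIL. -/
def HasNoSIL {V : Type} (G : SimpleGraph V) : Prop := ∀ x y z, ¬ IsSIL G x y z

/-- `D` is a (possibly empty) union of connected components of `Γ ∖ st(x)`. -/
def IsUnionCC {V : Type} (G : SimpleGraph V) (x : V) (D : Set V) : Prop :=
  ∃ 𝒞 : Set (Set V), (∀ C ∈ 𝒞, IsCC G ((star G x)ᶜ) C) ∧ D = ⋃₀ 𝒞


/-- Defining relators of the RAAG: commutators of adjacent vertices. -/
def Rels {V : Type} (G : SimpleGraph V) : Set (FreeGroup V) :=
  {r | ∃ u v : V, G.Adj u v ∧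
    r = FreeGroup.of u * FreeGroup.of v * (FreeGroup.of u)⁻¹ * (FreeGroup.of v)⁻¹}

/-- The right-angled Artin group on `G`. -/
abbrev Raag {V : Type} (G : SimpleGraph V) : Type := PresentedGroup (Rels G)

/-- The generator of `Raag G` corresponding to a vertex. -/
def gen {V : Type} (G : SimpleGraph V) (v : V) : Raag G := PresentedGroup.of v

/-- `φ` is the partial conjugation conjugating the vertices of `C` by `x`. -/
def IsPartialConj {V : Type} (G : SimpleGraph V) (x : V) (C : Set V)
    (φ : MulAut (Raag G)) : Prop :=
  (∀ v ∈ C, φ (gen G v) = (gen G x)⁻¹ * gen G v * gen G x) ∧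
  (∀ v ∉ C, φ (gen G v) = gen G v)

/-- `φ` is the transvection `R_u^v`, sending `u ↦ uv` and fixing all other vertices. -/
def IsTransvection {V : Type} (G : SimpleGraph V) (u v : V)
    (φ : MulAut (Raag G)) : Prop :=
  φ (gen G u) = gen G u * gen G v ∧ ∀ w : V, w ≠ u → φ (gen G w) = gen G w

/-- The subgroup of inner automorphisms of a group. -/
def Inn (H : Type*) [Group H] : Subgroup (MulAut H) := (MulAut.conj : H →* MulAut H).range

instance Inn.normal (H : Type*) [Group H] : (Inn H).Normal := by
  constructor
  rintro a ⟨g, rfl⟩ f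
  refine ⟨f g, ?_⟩
  ext x
  simp [MulAut.conj_apply, map_mul, map_inv]

/-- The outer automorphism group. -/
abbrev Out (H : Type*) [Group H] : Type _ := MulAut H ⧸ Inn H

/-- Projection from automorphisms to outer automorphisms. -/
def toOut (H : Type*) [Group H] : MulAut H →* Out H := QuotientGroup.mk' (Inn H)

/-- The homomorphism sending an automorphism to the induced automorphism of the
abelianization. -/
def abAut (H : Type*) [Group H] : MulAut H →* MulAut (Abelianization H) where
  toFun e := MulEquiv.abelianizationCongr e
  map_one' := by
    apply MulEquiv.toMonoidHom_injective
    apply Abelianization.hom_ext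
    ext x
    simp [abelianizationCongr_of]
  map_mul' f g := by
    apply MulEquiv.toMonoidHom_injective
    apply Abelianization.hom_ext
    ext x
    simp [abelianizationCongr_of, MulAut.mul_apply]

lemma abAut_inn (H : Type*) [Group H] : ∀ a ∈ Inn H, abAut H a = 1 := by
  rintro a ⟨g, rfl⟩
  apply MulEquiv.toMonoidHom_injective
  apply Abelianization.hom_ext
  ext x
  simp [abAut, abelianizationCongr_of, MulAut.conj_apply, mul_comm]

/-- The standard map `ρ : Out(H) → Aut(Hᵃᵇ)` induced by acting on the abelianization. -/
def rhoOut (H : Type*) [Group H] : Out H →* MulAut (Abelianization H) :=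
  QuotientGroup.lift (Inn H) (abAut H) (abAut_inn H)

end RaagPaper

namespace RaagPaper

/-- Auxiliary definition: some nonzero power of `π^x_C` can be written in `Out(A_Γ)` as a
product of partial conjugations (or their inverses) with multiplier `x` whose supports
are `y_i`-components for vertices `y_i` satisfying the predicate `P`. -/
def VirtObtAux {V : Type} (G : SimpleGraph V) (x : V) (C : Set V) (P : V → Prop) : Prop :=
  ∃ n : ℤ, n ≠ 0 ∧
    ∃ (m : ℕ) (y : Fin m → V) (D : Fin m → Set V) (ε : Fin m → ℤ)
      (φ : MulAut (Raag G)) (ψ : Fin m → MulAut (Raag G)),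
      (∀ i, P (y i)) ∧
      (∀ i, IsCC G ((star G (y i))ᶜ) (D i)) ∧
      (∀ i, ε i = 1 ∨ ε i = -1) ∧
      IsPartialConj G x C φ ∧
      (∀ i, IsPartialConj G x (D i) (ψ i)) ∧
      (toOut (Raag G) φ) ^ n
        = (List.ofFn fun i => (toOut (Raag G) (ψ i)) ^ (ε i)).prod

/-- `π^x_C` is virtually obtained from dominated components. -/
def VirtObtDom {V : Type} (G : SimpleGraph V) (x : V) (C : Set V) : Prop :=
  VirtObtAux G x C (fun y => Dom G y x ∧ y ≠ x)

/-- `π^x_C` is virtually obtained from dominated non-equivalent components. -/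
def VirtObtNE {V : Type} (G : SimpleGraph V) (x : V) (C : Set V) : Prop :=
  VirtObtAux G x C (fun y => Dom G y x ∧ ¬ EquivDom G y x)

/-- The pair `(X,C)`, of an equivalence class and an `X`-component, is non-principal. -/
def NonPrincipal {V : Type} (G : SimpleGraph V) (X C : Set V) : Prop :=
  ∀ x ∈ X, IsCC G ((star G x)ᶜ) C → VirtObtNE G x C

/-- The pair `(X,C)` is principal. -/
def Principal {V : Type} (G : SimpleGraph V) (X C : Set V) : Prop :=
  ¬ NonPrincipal G X C

/-- Condition (A2'): every principal pair `(X,C)` has `|X| > 1`. -/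
def CondA2' {V : Type} (G : SimpleGraph V) : Prop :=
  ∀ X C : Set V, (∃ x : V, X = eqClass G x) → (∃ x ∈ X, IsCC G ((star G x)ᶜ) C) →
    Principal G X C → X.Nontrivial

end RaagPaper

namespace RaagPaper

open Classical in
/-- The vector `w_D ∈ ℚ^r` associated to a set `D`: the `i`-th coordinate (for
`i = 1,…,r`, indexed here by `Fin r` via `i ↦ C i.succ`) is `1` if `C_i ⊆ D` and `0`
otherwise. -/
noncomputable def wVec {V : Type} (r : ℕ) (C : Fin (r + 1) → Set V) (D : Set V) :
    Fin r → ℚ :=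
  fun i => if C i.succ ⊆ D then 1 else 0

end RaagPaper

namespace RaagPaper

lemma exists_list_of_mem_closure_aux {H : Type*} [Group H] {S : Set H} {o : H}
    (h : o ∈ Subgroup.closure S) :
    ∃ l : List H, (∀ y ∈ l, y ∈ S ∨ y⁻¹ ∈ S) ∧ l.prod = o := by
  rw [← Subgroup.mem_toSubmonoid, Subgroup.closure_toSubmonoid] at h
  obtain ⟨l, h1, h2⟩ := Submonoid.exists_list_of_mem_closure h
  exact ⟨l, fun y hy => by simpa using h1 y hy, h2⟩

section graph
variable {V : Type} {G : SimpleGraph V}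

lemma IsCC.sub {S C : Set V} (h : IsCC G S C) : C ⊆ S := by
  obtain ⟨v, rfl⟩ := h
  rintro w ⟨h, -⟩
  exact h

lemma IsCC.nonempty {S C : Set V} (h : IsCC G S C) : ∃ v, v ∈ C := by
  obtain ⟨v, rfl⟩ := h
  exact ⟨v.1, v.2, Reachable.refl _⟩

lemma IsCC.closed {S C : Set V} (h : IsCC G S C) {u w : V} (hu : u ∈ C) (hw : w ∈ S)
    (ha : G.Adj u w) : w ∈ C := by
  obtain ⟨v, rfl⟩ := h
  obtain ⟨h1, h2⟩ := hu
  refine ⟨hw, Reachable.trans (Adj.reachable ?_) h2⟩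
  exact ha.symm

lemma IsCC.minimal {S C T : Set V} (h : IsCC G S C) {u : V} (hu : u ∈ C) (hT : u ∈ T)
    (hcl : ∀ a ∈ S, a ∈ T → ∀ b ∈ S, G.Adj a b → b ∈ T) : C ⊆ T := by
  obtain ⟨v, rfl⟩ := h
  obtain ⟨h1, h2⟩ := hu
  rintro w ⟨h3, h4⟩
  have h5 : (G.induce S).Reachable ⟨u, h1⟩ ⟨w, h3⟩ := h2.trans h4.symm
  obtain ⟨p⟩ := h5
  have key : ∀ (a b : S) (p : (G.induce S).Walk a b), a.1 ∈ T → b.1 ∈ T := by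
    intro a b p
    induction p with
    | nil => exact id
    | @cons a b c hab p ih => exact fun ha => ih (hcl _ a.2 ha _ b.2 hab)
  exact key _ _ p hT

lemma IsCC.eq_of_mem {S C C' : Set V} (h : IsCC G S C) (h' : IsCC G S C') {u : V}
    (hu : u ∈ C) (hu' : u ∈ C') : C = C' :=
  Set.Subset.antisymm
    (h.minimal hu hu' fun _ _ ha _ hb hab => h'.closed ha hb hab)
    (h'.minimal hu' hu fun _ _ ha _ hb hab => h.closed ha hb hab)

lemma exists_isCC {S : Set V} {v : V} (hv : v ∈ S) : ∃ C, IsCC G S C ∧ v ∈ C :=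
  ⟨_, ⟨⟨v, hv⟩, rfl⟩, hv, Reachable.refl _⟩

lemma dom_sub {x y : V} (hd : Dom G y x) {C D : Set V} (hC : IsCC G ((star G x)ᶜ) C)
    (hD : IsCC G ((star G y)ᶜ) D) {v : V} (hvC : v ∈ C) (hvD : v ∈ D) : C ⊆ D := by
  refine hC.minimal hvC hvD ?_
  intro a ha haD b hb hab
  refine hD.closed haD ?_ hab
  rintro (rfl | hy)
  · exact ha (hd hab.symm)
  · exact hb (hd hy)

end graph

section raag
variable {V : Type} {G : SimpleGraph V}

lemma gen_commute {u v : V} (h : G.Adj u v) : Commute (gen G u) (gen G v) := by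
  have : (PresentedGroup.mk (Rels G) (FreeGroup.of u * FreeGroup.of v * (FreeGroup.of u)⁻¹ *
      (FreeGroup.of v)⁻¹)) = 1 :=
    PresentedGroup.one_of_mem ⟨u, v, h, rfl⟩
  simp only [map_mul, map_inv] at this
  have h2 : gen G u * gen G v * (gen G u)⁻¹ * (gen G v)⁻¹ = 1 := this
  rw [mul_inv_eq_one, mul_inv_eq_iff_eq_mul] at h2
  exact h2

lemma star_commute {x u : V} (h : u ∈ star G x) : Commute (gen G u) (gen G x) := by
  rcases h with rfl | h
  · exact Commute.refl _
  · exact (gen_commute h).symm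

/-- A homomorphism from the group, defined on generators. -/
lemma exists_hom {H : Type*} [Group H] (f : V → H)
    (hf : ∀ u v, G.Adj u v → Commute (f u) (f v)) :
    ∃ F : Raag G →* H, ∀ v, F (gen G v) = f v := by
  have : ∀ r ∈ Rels G, FreeGroup.lift f r = 1 := by
    rintro r ⟨u, v, huv, rfl⟩
    have := (hf u v huv).eq
    simp [this]
  exact ⟨PresentedGroup.toGroup this, fun v => PresentedGroup.toGroup.of this⟩

lemma hom_ext_gen {H : Type*} [Group H] {F F' : Raag G →* H}
    (h : ∀ v, F (gen G v) = F' (gen G v)) : F = F' :=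
  PresentedGroup.ext h

lemma aut_ext_gen {F F' : MulAut (Raag G)}
    (h : ∀ v, F (gen G v) = F' (gen G v)) : F = F' := by
  have : F.toMonoidHom = F'.toMonoidHom := hom_ext_gen h
  exact MulEquiv.toMonoidHom_injective this

lemma partialConj_unique {x : V} {D : Set V} {φ ψ : MulAut (Raag G)}
    (h : IsPartialConj G x D φ) (h' : IsPartialConj G x D ψ) : φ = ψ := by
  apply aut_ext_gen
  intro v
  by_cases hv : v ∈ D
  · rw [h.1 v hv, h'.1 v hv]
  · rw [h.2 v hv, h'.2 v hv]

/-- multiplication by two on the rationals, as an action of the integers -/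
noncomputable def actTwo : Multiplicative ℤ →* MulAut (Multiplicative ℚ) :=
  zpowersHom _ (AddEquiv.toMultiplicative
    (DistribMulAction.toAddEquiv ℚ (Units.mk0 (2 : ℚ) two_ne_zero)))

lemma actTwo_apply (n : ℤ) (q : ℚ) :
    actTwo (Multiplicative.ofAdd n) (Multiplicative.ofAdd q) =
      Multiplicative.ofAdd ((2 : ℚ) ^ n * q) := by
  have hnat : ∀ (n : ℕ) (q : ℚ), actTwo (Multiplicative.ofAdd (n : ℤ)) (Multiplicative.ofAdd q) =
      Multiplicative.ofAdd ((2 : ℚ) ^ n * q) := by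
    intro n
    induction n with
    | zero => intro q; simp
    | succ n ih =>
      intro q
      have : Multiplicative.ofAdd ((n + 1 : ℕ) : ℤ) =
        Multiplicative.ofAdd (n : ℤ) * Multiplicative.ofAdd 1 := by
        rw [← ofAdd_add]; push_cast; rfl
      rw [this, map_mul, MulAut.mul_apply]
      have h1 : actTwo (Multiplicative.ofAdd 1) (Multiplicative.ofAdd q) =
        Multiplicative.ofAdd (2 * q) := by
        simp [actTwo, zpowersHom_apply]
      rw [h1, ih]
      congr 1
      ring
  obtain ⟨m, rfl | rfl⟩ := n.eq_nat_or_neg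
  · simpa using hnat m q
  · rw [ofAdd_neg, map_inv, MulAut.inv_apply, MulEquiv.symm_apply_eq, hnat]
    congr 1
    simp

/-- The exponent sum of `x` vanishes on the centralizer of a vertex not in the star. -/
lemma exists_exponent (G : SimpleGraph V) (x : V) : ∃ e : Raag G →* Multiplicative ℤ,
    e (gen G x) = Multiplicative.ofAdd 1 ∧
    ∀ v, v ∉ star G x → ∀ h : Raag G, Commute h (gen G v) → e h = 1 := by
  classical
  obtain ⟨e, he⟩ := exists_hom (G := G) (H := Multiplicative ℤ)
    (fun u => if u = x then Multiplicative.ofAdd 1 else 1) (fun _ _ _ => Commute.all _ _)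
  refine ⟨e, by simp [he], ?_⟩
  intro v hv h hcomm
  have hvx : v ≠ x := fun hh => hv (Or.inl hh)
  have hadj : ¬ G.Adj x v := fun hh => hv (Or.inr hh)
  obtain ⟨F, hF⟩ := exists_hom (G := G) (H := Multiplicative ℚ ⋊[actTwo] Multiplicative ℤ)
    (fun u => if u = x then SemidirectProduct.inr (Multiplicative.ofAdd 1) else
      if u = v then SemidirectProduct.inl (Multiplicative.ofAdd 1) else 1) (by
      intro a b hab
      have hne := hab.ne
      by_cases h1 : a = x
      · subst h1
        have h2 : b ≠ v := by rintro rfl; exact hadj hab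
        simp [hne.symm, h2]
      · by_cases h2 : b = x
        · subst h2
          have h2 : a ≠ v := by rintro rfl; exact hadj hab.symm
          simp [hne, h2]
        · by_cases h3 : a = v
          · subst h3
            simp [h2, hne.symm]
          · simp [h1, h3])
  have hright : SemidirectProduct.rightHom.comp F = e := by
    apply hom_ext_gen
    intro u
    simp only [MonoidHom.comp_apply, hF, he]
    by_cases h1 : u = x
    · simp [h1]
    · by_cases h2 : u = v
      · simp [h2, hvx]
      · simp [h1, h2]
  have hc : F h * F (gen G v) = F (gen G v) * F h := by
    rw [← map_mul, ← map_mul, hcomm.eq]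
  have hFv : F (gen G v) = SemidirectProduct.inl (Multiplicative.ofAdd 1) := by
    simp [hF, hvx]
  have hr : e h = (F h).right := by rw [← hright]; rfl
  rw [hFv] at hc
  have hl := congrArg SemidirectProduct.left hc
  simp only [SemidirectProduct.mul_left, SemidirectProduct.left_inl,
    SemidirectProduct.right_inl, map_one, MulAut.one_apply] at hl
  rw [mul_comm, mul_left_inj, ← hr] at hl
  obtain ⟨n, hn⟩ : ∃ n : ℤ, e h = Multiplicative.ofAdd n := ⟨(e h).toAdd, rfl⟩
  rw [hn] at hl ⊢
  rw [actTwo_apply] at hl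
  have h2 : (2 : ℚ) ^ n * 1 = 1 := Multiplicative.ofAdd.injective hl
  rw [mul_one, zpow_eq_one_iff_right₀ (by norm_num) (by norm_num)] at h2
  rw [h2]; rfl

lemma exists_pcHom {V : Type} (G : SimpleGraph V) (x : V)
    (r : ℕ) (C : Fin (r + 1) → Set V)
    (hC : ∀ i, IsCC G ((star G x)ᶜ) (C i))
    (hinj : Function.Injective C)
    (hall : ∀ S : Set V, IsCC G ((star G x)ᶜ) S → ∃ i, S = C i) :
    ∃ F : Multiplicative (Fin (r + 1) → ℤ) →* MulAut (Raag G),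
      (∀ f v i, v ∈ C i → F (Multiplicative.ofAdd f) (gen G v) =
        (gen G x) ^ (- f i) * gen G v * (gen G x) ^ (f i)) ∧
      (∀ f v, v ∈ star G x → F (Multiplicative.ofAdd f) (gen G v) = gen G v) := by
  classical
  let a : (Fin (r + 1) → ℤ) → V → ℤ := fun f v => ∑ i, if v ∈ C i then f i else 0
  have a_mem : ∀ f v i, v ∈ C i → a f v = f i := by
    intro f v i hv
    have : ∀ j, v ∈ C j → j = i := fun j hj => hinj ((hC j).eq_of_mem (hC i) hj hv)
    simp only [a]
    rw [Finset.sum_eq_single i]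
    · simp [hv]
    · intro j _ hj
      rw [if_neg]
      exact fun h => hj (this j h)
    · simp
  have a_star : ∀ f v, v ∈ star G x → a f v = 0 := by
    intro f v hv
    apply Finset.sum_eq_zero
    intro i _
    rw [if_neg]
    exact fun h => (hC i).sub h hv
  have a_add : ∀ f g v, a (f + g) v = a f v + a g v := by
    intro f g v
    simp only [a, ← Finset.sum_add_distrib]
    apply Finset.sum_congr rfl
    intro i _
    split_ifs <;> simp
  have key : ∀ f, ∃ F : Raag G →* Raag G, ∀ v, F (gen G v) =
      (gen G x) ^ (- a f v) * gen G v * (gen G x) ^ (a f v) := by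
    intro f
    apply exists_hom
    have hs : ∀ u v, u ∈ star G x → G.Adj u v →
        Commute (gen G x ^ (-a f u) * gen G u * gen G x ^ a f u)
          (gen G x ^ (-a f v) * gen G v * gen G x ^ a f v) := by
      intro u v hu huv
      rw [a_star f u hu]
      simp only [neg_zero, zpow_zero, one_mul, mul_one]
      have h1 := star_commute hu
      exact ((h1.zpow_right _).mul_right (gen_commute huv)).mul_right (h1.zpow_right _)
    intro u v huv
    by_cases hu : u ∈ star G x
    · exact hs u v hu huv
    by_cases hv : v ∈ star G x
    · exact (hs v u hv huv.symm).symm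
    obtain ⟨S, hS, huS⟩ := exists_isCC (G := G) (S := (star G x)ᶜ) hu
    obtain ⟨i, rfl⟩ := hall S hS
    have hvS := hS.closed huS hv huv
    rw [a_mem f u i huS, a_mem f v i hvS]
    have := (gen_commute huv).eq
    have h3 : ∀ (p : Raag G) (q s : Raag G), Commute q s → Commute (p⁻¹ * q * p) (p⁻¹ * s * p) := by
      intro p q s hqs
      have := hqs.eq
      show p⁻¹ * q * p * (p⁻¹ * s * p) = p⁻¹ * s * p * (p⁻¹ * q * p)
      calc _ = p⁻¹ * (q * s) * p := by group
        _ = p⁻¹ * (s * q) * p := by rw [this]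
        _ = _ := by group
    rw [zpow_neg]
    exact h3 _ _ _ (gen_commute huv)
  choose P hP using key
  have hxx : x ∈ star G x := Or.inl rfl
  have Px : ∀ f, P f (gen G x) = gen G x := by
    intro f
    rw [hP, a_star f x hxx]; simp
  have Padd : ∀ f g, P (f + g) = (P f).comp (P g) := by
    intro f g
    apply hom_ext_gen
    intro v
    rw [MonoidHom.comp_apply, hP, hP g, map_mul, map_mul, map_zpow, map_zpow, Px, hP, a_add]
    group
  have Pzero : P 0 = MonoidHom.id _ := by
    apply hom_ext_gen
    intro v
    rw [hP]
    have : a 0 v = 0 := by simp [a]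
    simp [this]
  let F : Multiplicative (Fin (r + 1) → ℤ) →* MulAut (Raag G) :=
    { toFun := fun f => MonoidHom.toMulEquiv (P f.toAdd) (P (-f.toAdd))
        (by rw [← Padd, neg_add_cancel, Pzero]) (by rw [← Padd, add_neg_cancel, Pzero])
      map_one' := by
        ext z
        show P 0 z = z
        rw [Pzero]; rfl
      map_mul' := by
        intro f g
        ext z
        show P (f.toAdd + g.toAdd) z = P f.toAdd (P g.toAdd z)
        rw [Padd]; rfl }
  have hFP : ∀ f z, F (Multiplicative.ofAdd f) z = P f z := fun f z => rfl
  refine ⟨F, ?_, ?_⟩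
  · intro f v i hv
    rw [hFP, hP, a_mem f v i hv]
  · intro f v hv
    rw [hFP, hP, a_star f v hv]; simp

end raag

end RaagPaper

open RaagPaper in
/-- With `C_0,…,C_r` the `x`-components and `Δ ⊆ ℚ^r` the set of
vectors `w_D` (for `y ≤ x` non-equivalent to `x` and `D` a `y`-component with
`C_0 ⊄ D`), together with `(1,…,1) − w_D` when `C_0 ⊆ D`, the vector `(1,…,1)` lies in
the span of `Δ` iff `π^x_{C_0}` is virtually obtained from dominated non-equivalent
components. -/
theorem statement7 {V : Type} [Fintype V] (G : SimpleGraph V) (x : V)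
    (r : ℕ) (C : Fin (r + 1) → Set V)
    (hC : ∀ i, IsCC G ((star G x)ᶜ) (C i))
    (hinj : Function.Injective C)
    (hall : ∀ S : Set V, IsCC G ((star G x)ᶜ) S → ∃ i, S = C i) :
    (fun _ : Fin r => (1 : ℚ)) ∈ Submodule.span ℚ
        {w : Fin r → ℚ | ∃ (y : V) (D : Set V),
          Dom G y x ∧ ¬ EquivDom G y x ∧ IsCC G ((star G y)ᶜ) D ∧
          ((¬ C 0 ⊆ D ∧ w = wVec r C D) ∨
           (C 0 ⊆ D ∧ w = (fun _ => 1) - wVec r C D))}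
      ↔ VirtObtNE G x (C 0) := by
  classical
  obtain ⟨F, hF1, hF2⟩ := exists_pcHom G x r C hC hinj hall
  have hcases : ∀ v, v ∈ RaagPaper.star G x ∨ ∃ i, v ∈ C i := by
    intro v
    by_cases hv : v ∈ RaagPaper.star G x
    · exact Or.inl hv
    · obtain ⟨S, hS, hvS⟩ := exists_isCC (G := G) (S := (RaagPaper.star G x)ᶜ) hv
      obtain ⟨i, rfl⟩ := hall S hS
      exact Or.inr ⟨i, hvS⟩
  -- partial conjugations in terms of F
  have hpc : ∀ D : Set V, (∀ i v, v ∈ C i → v ∈ D → C i ⊆ D) →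
      IsPartialConj G x D (F (Multiplicative.ofAdd fun i => if C i ⊆ D then 1 else 0)) := by
    intro D hD
    constructor
    · intro v hv
      rcases hcases v with h | ⟨i, hi⟩
      · rw [hF2 _ v h, mul_assoc, (star_commute h).eq, inv_mul_cancel_left]
      · rw [hF1 _ v i hi, if_pos (hD i v hi hv)]
        simp
    · intro v hv
      rcases hcases v with h | ⟨i, hi⟩
      · rw [hF2 _ v h]
      · rw [hF1 _ v i hi, if_neg (fun h => hv (h hi))]
        simp
  have hpcy : ∀ y D, Dom G y x → IsCC G ((RaagPaper.star G y)ᶜ) D →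
      IsPartialConj G x D (F (Multiplicative.ofAdd fun i => if C i ⊆ D then 1 else 0)) :=
    fun y D hd hD => hpc D fun i v hi hv => dom_sub hd (hC i) hD hi hv
  have hpc0 : IsPartialConj G x (C 0) (F (Multiplicative.ofAdd (Pi.single 0 1))) := by
    have h := hpc (C 0) (fun i v hi hv => ((hC i).eq_of_mem (hC 0) hi hv).le)
    convert h using 3
    ext i
    by_cases hi : i = 0
    · subst hi; simp
    · obtain ⟨v, hv⟩ := (hC i).nonempty
      have : ¬ C i ⊆ C 0 := fun h => hi (hinj ((hC i).eq_of_mem (hC 0) hv (h hv)))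
      simp [hi, this]
  -- the outer homomorphism
  let O : Multiplicative (Fin (r + 1) → ℤ) →* Out (Raag G) := (toOut (Raag G)).comp F
  have hO1 : ∀ c : ℤ, O (Multiplicative.ofAdd fun _ => c) = 1 := by
    intro c
    show toOut _ (F _) = 1
    refine (QuotientGroup.eq_one_iff _).2 ⟨(gen G x) ^ (-c), ?_⟩
    apply aut_ext_gen
    intro v
    rw [MulAut.conj_apply, ← zpow_neg, neg_neg]
    rcases hcases v with h | ⟨i, hi⟩
    · rw [hF2 _ v h, mul_assoc, ((star_commute h).zpow_right c).eq, ← mul_assoc, ← zpow_add]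
      simp
    · rw [hF1 _ v i hi]
  have hOker : ∀ f, O (Multiplicative.ofAdd f) = 1 → ∀ i j, f i = f j := by
    intro f hf
    obtain ⟨g, hg⟩ := (QuotientGroup.eq_one_iff _).1 hf
    obtain ⟨e, he1, he2⟩ := exists_exponent G x
    have : ∀ i, e g = Multiplicative.ofAdd (- f i) := by
      intro i
      obtain ⟨v, hv⟩ := (hC i).nonempty
      have h1 : MulAut.conj g (gen G v) = F (Multiplicative.ofAdd f) (gen G v) := by rw [hg]
      rw [MulAut.conj_apply, hF1 f v i hv] at h1
      have h2 : Commute (gen G x ^ (f i) * g) (gen G v) := by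
        show gen G x ^ (f i) * g * gen G v = gen G v * (gen G x ^ (f i) * g)
        calc _ = gen G x ^ (f i) * (g * gen G v * g⁻¹) * g := by group
          _ = _ := by rw [h1]; group
      have h3 := he2 v ((hC i).sub hv) _ h2
      rw [map_mul, map_zpow, he1, ← ofAdd_zsmul, mul_eq_one_iff_inv_eq] at h3
      rw [← h3]; simp
    intro i j
    have := (this i).symm.trans (this j)
    exact neg_injective (Multiplicative.ofAdd.injective this)
  let S : Set (Out (Raag G)) := {o | ∃ (y : V) (D : Set V) (ψ : MulAut (Raag G)),
    (Dom G y x ∧ ¬ EquivDom G y x) ∧ IsCC G ((RaagPaper.star G y)ᶜ) D ∧ IsPartialConj G x D ψ ∧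
    o = toOut _ ψ}
  have hvirt : VirtObtNE G x (C 0) ↔ ∃ n : ℤ, n ≠ 0 ∧
      O (Multiplicative.ofAdd (Pi.single 0 n)) ∈ Subgroup.closure S := by
    have hpow : ∀ n : ℤ, O (Multiplicative.ofAdd (Pi.single 0 n)) =
        (toOut _ (F (Multiplicative.ofAdd (Pi.single 0 1)))) ^ n := by
      intro n
      show O _ = (O _) ^ n
      rw [← map_zpow, ← ofAdd_zsmul]
      congr 2
      ext i
      by_cases hi : i = 0
      · subst hi; simp
      · simp [hi]
    constructor
    · rintro ⟨n, hn, m, y, D, ε, φ, ψ, hy, hD, hε, hφ, hψ, heq⟩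
      refine ⟨n, hn, ?_⟩
      rw [hpow, ← partialConj_unique hφ hpc0, heq]
      apply Subgroup.list_prod_mem
      intro o ho
      obtain ⟨i, rfl⟩ := (List.mem_ofFn' _ _).1 ho
      have hi : toOut _ (ψ i) ∈ S := ⟨y i, D i, ψ i, hy i, hD i, hψ i, rfl⟩
      exact Subgroup.zpow_mem _ (Subgroup.subset_closure hi) _
    · rintro ⟨n, hn, hmem⟩
      obtain ⟨l, hl, hprod⟩ := exists_list_of_mem_closure_aux hmem
      have hex : ∀ o ∈ l, ∃ (y : V) (D : Set V) (ψ : MulAut (Raag G)) (ε : ℤ),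
          (Dom G y x ∧ ¬ EquivDom G y x) ∧ IsCC G ((RaagPaper.star G y)ᶜ) D ∧
          IsPartialConj G x D ψ ∧ (ε = 1 ∨ ε = -1) ∧ o = toOut _ ψ ^ ε := by
        intro o ho
        rcases hl o ho with ⟨y, D, ψ, h1, h2, h3, h4⟩ | ⟨y, D, ψ, h1, h2, h3, h4⟩
        · exact ⟨y, D, ψ, 1, h1, h2, h3, Or.inl rfl, by simpa using h4⟩
        · exact ⟨y, D, ψ, -1, h1, h2, h3, Or.inr rfl, by rw [← h4]; simp⟩
      choose y D ψ ε h1 h2 h3 h4 h5 using fun i : Fin l.length => hex (l.get i) (l.get_mem i)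
      refine ⟨n, hn, l.length, y, D, ε, _, ψ, h1, h2, h4, hpc0, h3, ?_⟩
      rw [← hpow, ← hprod]
      congr 1
      have : (fun i => toOut (Raag G) (ψ i) ^ ε i) = l.get := by
        ext i; exact (h5 i).symm
      rw [this, List.ofFn_get]
  rw [hvirt]
  constructor
  · intro hspan
    have key : ∀ w ∈ Submodule.span ℚ
        {w : Fin r → ℚ | ∃ (y : V) (D : Set V),
          Dom G y x ∧ ¬ EquivDom G y x ∧ IsCC G ((RaagPaper.star G y)ᶜ) D ∧
          ((¬ C 0 ⊆ D ∧ w = wVec r C D) ∨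
           (C 0 ⊆ D ∧ w = (fun _ => 1) - wVec r C D))},
        ∃ n : ℤ, n ≠ 0 ∧ ∃ f : Fin (r + 1) → ℤ, f 0 = 0 ∧ (∀ i : Fin r, n * w i = f i.succ) ∧
          O (Multiplicative.ofAdd f) ∈ Subgroup.closure S := by
      intro w hw
      induction hw using Submodule.span_induction with
      | mem w hw =>
        obtain ⟨y, D, hd, hne, hD, ⟨h0, rfl⟩ | ⟨h0, rfl⟩⟩ := hw
        · refine ⟨1, one_ne_zero, fun i => if C i ⊆ D then 1 else 0, by simp [h0], ?_, ?_⟩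
          · intro i; simp [wVec]
          · exact Subgroup.subset_closure ⟨y, D, _, ⟨hd, hne⟩, hD, hpcy y D hd hD, rfl⟩
        · refine ⟨1, one_ne_zero, (fun _ => 1) - fun i => if C i ⊆ D then 1 else 0,
            by simp [h0], ?_, ?_⟩
          · intro i; simp [wVec]
          · rw [ofAdd_sub, map_div, hO1, one_div]
            exact Subgroup.inv_mem _ (Subgroup.subset_closure
              ⟨y, D, _, ⟨hd, hne⟩, hD, hpcy y D hd hD, rfl⟩)
      | zero => exact ⟨1, one_ne_zero, 0, rfl, by simp, by simp [Subgroup.one_mem]⟩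
      | add w w' _ _ ih ih' =>
        obtain ⟨n, hn, f, hf0, hf, hm⟩ := ih
        obtain ⟨n', hn', f', hf0', hf', hm'⟩ := ih'
        refine ⟨n * n', mul_ne_zero hn hn', n' • f + n • f', by simp [hf0, hf0'], ?_, ?_⟩
        · intro i
          simp only [Pi.add_apply, Pi.smul_apply, smul_eq_mul]
          push_cast
          rw [← hf, ← hf']
          ring
        · rw [ofAdd_add, ofAdd_zsmul, ofAdd_zsmul, map_mul, map_zpow, map_zpow]
          exact Subgroup.mul_mem _ (Subgroup.zpow_mem _ hm _) (Subgroup.zpow_mem _ hm' _)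
      | smul q w _ ih =>
        obtain ⟨n, hn, f, hf0, hf, hm⟩ := ih
        refine ⟨n * q.den, mul_ne_zero hn (by exact_mod_cast q.den_ne_zero), q.num • f,
          by simp [hf0], ?_, ?_⟩
        · intro i
          simp only [Pi.smul_apply, smul_eq_mul]
          push_cast
          rw [← hf]
          calc (n : ℚ) * q.den * (q * w i) = (q * q.den) * (n * w i) := by ring
            _ = _ := by rw [Rat.mul_den_eq_num]
        · rw [ofAdd_zsmul, map_zpow]
          exact Subgroup.zpow_mem _ hm _
    obtain ⟨n, hn, f, hf0, hf, hm⟩ := key _ hspan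
    refine ⟨n, hn, ?_⟩
    have : (Pi.single 0 n : Fin (r + 1) → ℤ) = (fun _ => n) - f := by
      ext i
      refine Fin.cases ?_ (fun i => ?_) i
      · simp [hf0]
      · have := hf i
        rw [mul_one] at this
        have h : n = f i.succ := by exact_mod_cast this
        simp [← h]
    rw [this, ofAdd_sub, map_div, hO1, one_div]
    exact Subgroup.inv_mem _ hm
  · rintro ⟨n, hn, hmem⟩
    set W := Submodule.span ℚ
        {w : Fin r → ℚ | ∃ (y : V) (D : Set V),
          Dom G y x ∧ ¬ EquivDom G y x ∧ IsCC G ((RaagPaper.star G y)ᶜ) D ∧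
          ((¬ C 0 ⊆ D ∧ w = wVec r C D) ∨
           (C 0 ⊆ D ∧ w = (fun _ => 1) - wVec r C D))} with hW
    have key : ∀ o ∈ Subgroup.closure S, ∃ f : Fin (r + 1) → ℤ, O (Multiplicative.ofAdd f) = o ∧
        (fun i : Fin r => (f 0 : ℚ) - f i.succ) ∈ W := by
      intro o ho
      induction ho using Subgroup.closure_induction with
      | mem o ho =>
        obtain ⟨y, D, ψ, ⟨hd, hne⟩, hD, hψ, rfl⟩ := ho
        refine ⟨fun i => if C i ⊆ D then 1 else 0, ?_, ?_⟩
        · rw [partialConj_unique hψ (hpcy y D hd hD)]; rfl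
        · by_cases h0 : C 0 ⊆ D
          · apply Submodule.subset_span
            refine ⟨y, D, hd, hne, hD, Or.inr ⟨h0, ?_⟩⟩
            ext i
            simp [h0, wVec]
          · rw [← neg_mem_iff]
            apply Submodule.subset_span
            refine ⟨y, D, hd, hne, hD, Or.inl ⟨h0, ?_⟩⟩
            ext i
            simp [h0, wVec]
      | one => exact ⟨0, by simp, by
        convert W.zero_mem using 1
        ext i
        simp⟩
      | mul o o' _ _ ih ih' =>
        obtain ⟨f, rfl, hf⟩ := ih
        obtain ⟨f', rfl, hf'⟩ := ih'
        refine ⟨f + f', by rw [ofAdd_add, map_mul], ?_⟩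
        convert W.add_mem hf hf' using 1
        ext i
        simp only [Pi.add_apply]
        push_cast
        ring
      | inv o _ ih =>
        obtain ⟨f, rfl, hf⟩ := ih
        refine ⟨-f, by rw [ofAdd_neg, map_inv], ?_⟩
        convert W.neg_mem hf using 1
        ext i
        simp only [Pi.neg_apply]
        push_cast
        ring
    obtain ⟨f, hf, hfW⟩ := key _ hmem
    have hk := hOker (Pi.single 0 n - f) (by rw [ofAdd_sub, map_div, hf, div_self'])
    convert W.smul_mem ((n : ℚ)⁻¹) hfW using 1
    ext i
    have h1 := hk 0 i.succ
    simp at h1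
    have h2 : (f 0 : ℚ) - f i.succ = n := by
      have : f 0 - f i.succ = n := by omega
      exact_mod_cast this
    have hn' : (n : ℚ) ≠ 0 := by exact_mod_cast hn
    simp [h2, hn']
end

section
/- Let Γ be a finite simplicial graph that fails condition (A2'). Then Aut(A_Γ) has a finite-index subgroup that admits a surjective group homomorphism onto ℤ. -/
open SimpleGraph

namespace RaagProof
open RaagPaper

section
open scoped Classical

/-- A three-step nilpotent group of integer quadruples, used as a target for the group `A_Γ`. -/
@[ext] structure N4 where
  k : ℤ
  d0 : ℤ
  d1 : ℤ
  d2 : ℤ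

namespace N4

instance : Mul N4 :=
  ⟨fun a b => ⟨a.k + b.k, a.d0 + b.d0, a.d1 + b.d1 + a.k * b.d0,
    a.d2 + b.d2 + 2 * a.k * b.d1 + a.k ^ 2 * b.d0⟩⟩
instance : One N4 := ⟨⟨0, 0, 0, 0⟩⟩
instance : Inv N4 :=
  ⟨fun a => ⟨-a.k, -a.d0, -a.d1 + a.k * a.d0, -a.d2 + 2 * a.k * a.d1 - a.k ^ 2 * a.d0⟩⟩

@[simp] lemma mul_k (a b : N4) : (a * b).k = a.k + b.k := rfl
@[simp] lemma mul_d0 (a b : N4) : (a * b).d0 = a.d0 + b.d0 := rfl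
@[simp] lemma mul_d1 (a b : N4) : (a * b).d1 = a.d1 + b.d1 + a.k * b.d0 := rfl
@[simp] lemma mul_d2 (a b : N4) :
    (a * b).d2 = a.d2 + b.d2 + 2 * a.k * b.d1 + a.k ^ 2 * b.d0 := rfl
@[simp] lemma one_k : (1 : N4).k = 0 := rfl
@[simp] lemma one_d0 : (1 : N4).d0 = 0 := rfl
@[simp] lemma one_d1 : (1 : N4).d1 = 0 := rfl
@[simp] lemma one_d2 : (1 : N4).d2 = 0 := rfl
@[simp] lemma inv_k (a : N4) : (a⁻¹).k = -a.k := rfl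
@[simp] lemma inv_d0 (a : N4) : (a⁻¹).d0 = -a.d0 := rfl
@[simp] lemma inv_d1 (a : N4) : (a⁻¹).d1 = -a.d1 + a.k * a.d0 := rfl
@[simp] lemma inv_d2 (a : N4) :
    (a⁻¹).d2 = -a.d2 + 2 * a.k * a.d1 - a.k ^ 2 * a.d0 := rfl

instance : Group N4 := Group.ofLeftAxioms
  (by intro a b c; ext <;> simp <;> ring)
  (by intro a; ext <;> simp)
  (by intro a; ext <;> simp <;> ring)

end N4

variable {V : Type} {G : SimpleGraph V}

lemma raag_ind {p : Raag G → Prop} (h1 : p 1) (hg : ∀ v, p (gen G v))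
    (hm : ∀ y z, p y → p z → p (y * z)) (hi : ∀ y, p y → p y⁻¹) (y : Raag G) : p y := by
  induction y using PresentedGroup.induction_on with
  | _ w =>
    induction w using FreeGroup.induction_on with
    | C1 => simpa using h1
    | of v => exact hg v
    | inv_of v ih => rw [map_inv]; exact hi _ ih
    | mul a b ha hb => rw [map_mul]; exact hm _ _ ha hb

lemma gen_comm {u v : V} (h : G.Adj u v) : Commute (gen G u) (gen G v) := by
  have h1 : PresentedGroup.mk (Rels G)
      (FreeGroup.of u * FreeGroup.of v * (FreeGroup.of u)⁻¹ * (FreeGroup.of v)⁻¹) = 1 :=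
    PresentedGroup.one_of_mem ⟨u, v, h, rfl⟩
  simp only [map_mul, map_inv] at h1
  have h2 := mul_inv_eq_one.mp h1
  exact mul_inv_eq_iff_eq_mul.mp h2

/-- A homomorphism out of the RAAG. -/
noncomputable def liftR {K : Type} [Group K] (f : V → K)
    (hf : ∀ u v, G.Adj u v → Commute (f u) (f v)) : Raag G →* K :=
  PresentedGroup.toGroup (f := f) (by
    rintro r ⟨u, v, h, rfl⟩
    simp only [map_mul, map_inv, FreeGroup.lift_apply_of]
    rw [(hf u v h).eq]; group)

lemma liftR_gen {K : Type} [Group K] (f : V → K)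
    (hf : ∀ u v, G.Adj u v → Commute (f u) (f v)) (v : V) :
    liftR (G := G) f hf (gen G v) = f v := PresentedGroup.toGroup.of _

/-- The image of a vertex under the representation with parameters `c`, `r`. -/
noncomputable def thetaV (G : SimpleGraph V) (c : V) (r : V → ℤ) (v : V) : N4 :=
  ⟨if G.Adj c v then 0 else r v, if v = c then 1 else 0, 0, 0⟩

noncomputable def theta (G : SimpleGraph V) (c : V) (r : V → ℤ) : Raag G →* N4 :=
  liftR (thetaV G c r) (by
    intro u v h
    have hne := h.ne
    have h' := h.symm
    unfold Commute SemiconjBy thetaV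
    ext <;> simp <;> split_ifs <;> simp_all [add_comm])

noncomputable def Kf (G : SimpleGraph V) (c : V) (r : V → ℤ) (y : Raag G) : ℤ := (theta G c r y).k
noncomputable def Mf (G : SimpleGraph V) (c : V) (r : V → ℤ) (y : Raag G) : ℤ := (theta G c r y).d1
noncomputable def mf (G : SimpleGraph V) (c : V) (y : Raag G) : ℤ := (theta G c 0 y).d0

lemma theta_gen (c : V) (r : V → ℤ) (v : V) : theta G c r (gen G v) = thetaV G c r v :=
  liftR_gen _ _ _

@[simp] lemma mf_one (c : V) : mf G c 1 = 0 := by simp [mf]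
@[simp] lemma mf_mul (c : V) (y z : Raag G) : mf G c (y * z) = mf G c y + mf G c z := by simp [mf]
@[simp] lemma mf_inv (c : V) (y : Raag G) : mf G c y⁻¹ = - mf G c y := by simp [mf]
@[simp] lemma mf_gen (c v : V) : mf G c (gen G v) = if v = c then 1 else 0 := by
  simp [mf, theta_gen, thetaV]

lemma theta_d0 (c : V) (r : V → ℤ) (y : Raag G) : (theta G c r y).d0 = mf G c y := by
  induction y using raag_ind with
  | h1 => simp
  | hg v => simp [theta_gen, thetaV]
  | hm y z hy hz => simp [hy, hz]
  | hi y hy => simp [hy]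

@[simp] lemma Kf_one (c : V) (r : V → ℤ) : Kf G c r 1 = 0 := by simp [Kf]
@[simp] lemma Kf_mul (c : V) (r : V → ℤ) (y z : Raag G) :
    Kf G c r (y * z) = Kf G c r y + Kf G c r z := by simp [Kf]
@[simp] lemma Kf_inv (c : V) (r : V → ℤ) (y : Raag G) : Kf G c r y⁻¹ = - Kf G c r y := by simp [Kf]
@[simp] lemma Kf_gen (c : V) (r : V → ℤ) (v : V) :
    Kf G c r (gen G v) = if G.Adj c v then 0 else r v := by simp [Kf, theta_gen, thetaV]
@[simp] lemma Mf_one (c : V) (r : V → ℤ) : Mf G c r 1 = 0 := by simp [Mf]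
@[simp] lemma Mf_mul (c : V) (r : V → ℤ) (y z : Raag G) :
    Mf G c r (y * z) = Mf G c r y + Mf G c r z + Kf G c r y * mf G c z := by
  simp [Mf, Kf, theta_d0]
@[simp] lemma Mf_inv (c : V) (r : V → ℤ) (y : Raag G) :
    Mf G c r y⁻¹ = - Mf G c r y + Kf G c r y * mf G c y := by
  simp [Mf, Kf, theta_d0]
@[simp] lemma Mf_gen (c : V) (r : V → ℤ) (v : V) : Mf G c r (gen G v) = 0 := by
  simp [Mf, theta_gen, thetaV]

lemma Kf_add (c : V) (r s : V → ℤ) (y : Raag G) : Kf G c (r + s) y = Kf G c r y + Kf G c s y := by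
  induction y using raag_ind with
  | h1 => simp
  | hg v => simp; split_ifs <;> simp
  | hm y z hy hz => simp [hy, hz]; ring
  | hi y hy => simp [hy]; ring

lemma Kf_smul (c : V) (t : ℤ) (s : V → ℤ) (y : Raag G) : Kf G c (t • s) y = t * Kf G c s y := by
  induction y using raag_ind with
  | h1 => simp
  | hg v => simp
  | hm y z hy hz => rw [Kf_mul, hy, hz, Kf_mul]; ring
  | hi y hy => rw [Kf_inv, hy, Kf_inv]; ring

lemma Mf_add (c : V) (r s : V → ℤ) (y : Raag G) : Mf G c (r + s) y = Mf G c r y + Mf G c s y := by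
  induction y using raag_ind with
  | h1 => simp
  | hg v => simp
  | hm y z hy hz => simp [hy, hz, Kf_add]; ring
  | hi y hy => simp [hy, Kf_add]; ring

lemma Mf_smul (c : V) (t : ℤ) (s : V → ℤ) (y : Raag G) : Mf G c (t • s) y = t * Mf G c s y := by
  induction y using raag_ind with
  | h1 => simp
  | hg v => simp
  | hm y z hy hz => rw [Mf_mul, hy, hz, Mf_mul, Kf_smul]; ring
  | hi y hy => rw [Mf_inv, hy, Mf_inv, Kf_smul]; ring

lemma Kf_eq [Fintype V] (c : V) (r : V → ℤ) (y : Raag G) :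
    Kf G c r y = ∑ w, (if G.Adj c w then 0 else r w) * mf G w y := by
  induction y using raag_ind with
  | h1 => simp
  | hg v => simp
  | hm y z hy hz => simp only [Kf_mul, mf_mul, hy, hz, mul_add, Finset.sum_add_distrib]
  | hi y hy => simp only [Kf_inv, mf_inv, hy, mul_neg, Finset.sum_neg_distrib]

/-- The coordinate form. -/
noncomputable def del (a : V) : V → ℤ := fun b => if b = a then 1 else 0

lemma Kf_del [Fintype V] (c a : V) (h : ¬ G.Adj c a) (y : Raag G) :
    Kf G c (del a) y = mf G a y := by
  rw [Kf_eq, Finset.sum_eq_single a]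
  · simp [h, del]
  · intro b _ hb; simp [del, hb]
  · simp

lemma com1 {P Q : Raag G} (h : Commute P Q) (c : V) (r : V → ℤ) :
    Kf G c r P * mf G c Q = Kf G c r Q * mf G c P := by
  have := congrArg (Mf G c r) h.eq
  simp at this
  linarith

lemma com2 {P Q : Raag G} (h : Commute P Q) (c : V) (r : V → ℤ) (hP : mf G c P = 0)
    (hQ : mf G c Q = 0) : Kf G c r P * Mf G c r Q = Kf G c r Q * Mf G c r P := by
  have := congrArg (fun y => (theta G c r y).d2) h.eq
  simp [theta_d0, hP, hQ] at this
  simp only [Kf, Mf]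
  linarith

/-- The polarized form of `com2`. -/
lemma com3 {P Q : Raag G} (h : Commute P Q) (c : V) (r s : V → ℤ) (hP : mf G c P = 0)
    (hQ : mf G c Q = 0) : Kf G c r P * Mf G c s Q + Kf G c s P * Mf G c r Q
      = Kf G c r Q * Mf G c s P + Kf G c s Q * Mf G c r P := by
  have h1 := com2 h c (r + s) hP hQ
  have h2 := com2 h c r hP hQ
  have h3 := com2 h c s hP hQ
  simp only [Kf_add, Mf_add] at h1
  linarith

/-! Action on the abelianization. -/

/-- The matrix of an automorphism. -/
noncomputable def gm (φ : MulAut (Raag G)) : Matrix V V ℤ := fun w v => mf G w (φ (gen G v))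

variable [Fintype V]

lemma mf_app (φ : MulAut (Raag G)) (w : V) (y : Raag G) :
    mf G w (φ y) = ∑ v, gm φ w v * mf G v y := by
  induction y using raag_ind with
  | h1 => simp
  | hg v => simp [gm]
  | hm y z hy hz => simp only [map_mul, mf_mul, hy, hz, mul_add, Finset.sum_add_distrib]
  | hi y hy => simp only [map_inv, mf_inv, hy, mul_neg, Finset.sum_neg_distrib]

lemma gm_mul (φ ψ : MulAut (Raag G)) : gm (φ * ψ) = gm φ * gm ψ := by
  ext w v
  rw [Matrix.mul_apply]
  change mf G w (φ (ψ (gen G v))) = _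
  rw [mf_app]; rfl

lemma gm_one : gm (1 : MulAut (Raag G)) = 1 := by
  ext w v
  simp [gm, Matrix.one_apply, eq_comm]

/-- Reduction of the matrix modulo three. -/
noncomputable def gm3 (G : SimpleGraph V) : MulAut (Raag G) →* Matrix V V (ZMod 3) where
  toFun φ := (Int.castRingHom (ZMod 3)).mapMatrix (gm φ)
  map_one' := by rw [gm_one, map_one]
  map_mul' φ ψ := by rw [gm_mul, map_mul]

/-- The level three congruence subgroup. -/
noncomputable def H3 (G : SimpleGraph V) : Subgroup (MulAut (Raag G)) := (gm3 G).toHomUnits.ker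

lemma H3_finiteIndex : (H3 G).FiniteIndex := by
  unfold H3
  infer_instance

lemma mem_H3 {φ : MulAut (Raag G)} :
    φ ∈ H3 G ↔ (Int.castRingHom (ZMod 3)).mapMatrix (gm φ) = 1 := by
  unfold H3
  rw [MonoidHom.mem_ker, Units.ext_iff]
  rfl

lemma H3_diag {φ : MulAut (Raag G)} (h : φ ∈ H3 G) (a : V) : ((gm φ a a : ℤ) : ZMod 3) = 1 := by
  have := congrFun (congrFun (mem_H3.mp h) a) a
  simpa using this

lemma H3_off {φ : MulAut (Raag G)} (h : φ ∈ H3 G) {a b : V} (hab : a ≠ b) :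
    ((gm φ a b : ℤ) : ZMod 3) = 0 := by
  have := congrFun (congrFun (mem_H3.mp h) a) b
  simpa [hab] using this

lemma H3_diag_ne {φ : MulAut (Raag G)} (h : φ ∈ H3 G) (a : V) : gm φ a a ≠ 0 := by
  intro h0
  have := H3_diag h a
  rw [h0] at this
  simp at this

lemma app_comm (φ : MulAut (Raag G)) {u v : V} (h : G.Adj u v) :
    Commute (φ (gen G u)) (φ (gen G v)) := (gen_comm h).map φ

lemma mem_star {u v : V} : u ∈ star G v ↔ u = v ∨ G.Adj v u := by
  simp [RaagPaper.star]

lemma dom_trans {u v w : V} (h1 : Dom G u v) (h2 : Dom G v w) : Dom G u w := by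
  intro t ht
  have ht' : G.Adj u t := ht
  rcases mem_star.mp (h1 ht) with rfl | h
  · rcases mem_star.mp (h2 ht'.symm) with rfl | h3
    · exact mem_star.mpr (Or.inr ht')
    · rcases mem_star.mp (h1 h3.symm) with h4 | h4
      · exact mem_star.mpr (Or.inl h4.symm)
      · exact mem_star.mpr (Or.inr h4.symm)
  · exact h2 h

/-- Automorphisms in the congruence subgroup act on homology compatibly with domination. -/
lemma gm_dom {φ : MulAut (Raag G)} (h : φ ∈ H3 G) {w v : V} (hwv : gm φ w v ≠ 0) : Dom G v w := by
  intro u hu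
  have hu' : G.Adj v u := hu
  by_contra hw
  apply hwv
  let S := {s : V // s ∈ star G v}
  let A : Matrix S S ℤ := (gm φ).submatrix Subtype.val Subtype.val
  have hdet : A.det ≠ 0 := by
    intro h0
    have h1 : (Int.castRingHom (ZMod 3)) A.det = 1 := by
      rw [RingHom.map_det]
      have : (Int.castRingHom (ZMod 3)).mapMatrix A = 1 := by
        ext i j
        by_cases hij : i = j
        · subst hij; simpa [A] using H3_diag h i.1
        · have : i.1 ≠ j.1 := fun h => hij (Subtype.ext h)
          simpa [A, hij] using H3_off h this
      rw [this, Matrix.det_one]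
    rw [h0] at h1
    simp at h1
  let u' : S := ⟨u, mem_star.mpr (Or.inr hu')⟩
  let v' : S := ⟨v, mem_star.mpr (Or.inl rfl)⟩
  let k : V → ℤ := fun b => ∑ s : S, gm φ b s.1 * A.adjugate s u'
  have hk : ∀ b : S, k b.1 = if b = u' then A.det else 0 := by
    intro b
    have := congrFun (congrFun (Matrix.mul_adjugate A) b) u'
    rw [Matrix.mul_apply] at this
    rw [show k b.1 = ∑ j, A b j * A.adjugate j u' from rfl, this]
    simp [Matrix.one_apply]
  have hcom : ∀ a b : V, ¬ G.Adj b a → gm φ a v * k b = k a * gm φ b v := by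
    intro a b hab
    simp only [k, Finset.mul_sum, Finset.sum_mul]
    refine Finset.sum_congr rfl fun s _ => ?_
    have hc : Commute (φ (gen G v)) (φ (gen G s.1)) := by
      rcases mem_star.mp s.2 with h1 | h1
      · rw [h1]
      · exact app_comm φ h1
    have := com1 hc b (del a)
    rw [Kf_del _ _ hab, Kf_del _ _ hab] at this
    change gm φ a v * gm φ b s.1 = gm φ a s.1 * gm φ b v at this
    linear_combination (A.adjugate s u') * this
  have hkv : k v = 0 := by
    have h1 := hk v'
    rw [if_neg] at h1
    · exact h1
    · intro h2; exact hu'.ne (congrArg Subtype.val h2)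
  have hk0 : ∀ b, b ≠ u → k b = 0 := by
    intro b hb
    by_cases hbs : b ∈ star G v
    · have h1 := hk ⟨b, hbs⟩
      rw [if_neg] at h1
      · exact h1
      · intro h2; exact hb (congrArg Subtype.val h2)
    · have h1 := hcom v b (fun h2 => hbs (mem_star.mpr (Or.inr h2.symm)))
      rw [hkv, zero_mul] at h1
      exact (mul_eq_zero.mp h1).resolve_left (H3_diag_ne h v)
  have hku : k u = A.det := by simpa [u'] using hk u'
  have hwu : w ≠ u := fun h2 => hw (mem_star.mpr (Or.inl h2.symm))
  have h1 := hcom w u (fun h2 => hw (mem_star.mpr (Or.inr h2.symm)))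
  rw [hk0 w hwu, hku, zero_mul] at h1
  exact (mul_eq_zero.mp h1).resolve_right hdet

lemma gm_inv_mul (φ : MulAut (Raag G)) : gm φ * gm φ⁻¹ = 1 := by
  rw [← gm_mul, mul_inv_cancel, gm_one]

lemma gm_self {φ : MulAut (Raag G)} (h : φ ∈ H3 G) (x : V) (hx : ∀ y, EquivDom G y x → y = x) :
    gm φ x x = 1 := by
  have h1 := congrFun (congrFun (gm_inv_mul φ) x) x
  rw [Matrix.mul_apply, Finset.sum_eq_single x, Matrix.one_apply_eq] at h1
  · rcases Int.isUnit_iff.mp (IsUnit.of_mul_eq_one _ h1) with h2 | h2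
    · exact h2
    · have := H3_diag h x
      rw [h2] at this
      exact absurd this (by decide)
  · intro b _ hb
    by_contra h0
    apply hb
    apply hx
    exact ⟨gm_dom h (left_ne_zero_of_mul h0), gm_dom ((H3 G).inv_mem h) (right_ne_zero_of_mul h0)⟩
  · simp

/-- `a` is outside the star of `c` and not dominated by `c`. -/
def Good (G : SimpleGraph V) (c a : V) : Prop := a ∉ star G c ∧ ¬ Dom G a c

lemma mem_star_comm {a c : V} : a ∈ star G c ↔ c ∈ star G a := by
  rw [mem_star, mem_star, G.adj_comm, eq_comm]

lemma good_mono {c x a : V} (hc : Dom G c x) (h : Good G x a) : Good G c a := by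
  refine ⟨fun h1 => ?_, fun h1 => h.2 (dom_trans h1 hc)⟩
  rcases mem_star.mp h1 with rfl | h2
  · exact h.2 hc
  · exact h.1 (hc h2)

lemma good_nbr {c a : V} (h : Good G c a) : ∃ e, G.Adj a e ∧ Good G c e := by
  obtain ⟨e, he, he'⟩ := Set.not_subset.mp h.2
  exact ⟨e, he, he', fun h1 => h.1 (h1 (SimpleGraph.Adj.symm he))⟩

lemma good_of_adj {c a e : V} (h : G.Adj a e) (ha : a ∉ star G c) (he : e ∉ star G c) :
    Good G c a := ⟨ha, fun h1 => he (h1 h)⟩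

lemma mf_good {φ : MulAut (Raag G)} (h : φ ∈ H3 G) {c w : V} (hw : ¬ Dom G w c) :
    mf G c (φ (gen G w)) = 0 := by
  by_contra h1
  exact hw (gm_dom h h1)

lemma not_adj_of_row {φ : MulAut (Raag G)} (h : φ ∈ H3 G) {c a b : V} (ha : a ∉ star G c)
    (hb : gm φ a b ≠ 0) : ¬ G.Adj c b := fun h1 =>
  ha (mem_star_comm.mp (gm_dom h hb h1.symm))

lemma Kf_row {φ : MulAut (Raag G)} (h : φ ∈ H3 G) {c a : V} (ha : a ∉ star G c) (y : Raag G) :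
    Kf G c (gm φ a) y = mf G a (φ y) := by
  rw [Kf_eq, mf_app]
  refine Finset.sum_congr rfl fun b _ => ?_
  split_ifs with h1
  · by_cases h2 : gm φ a b = 0
    · simp [h2]
    · exact absurd h1 (not_adj_of_row h ha h2)
  · rfl

/-- The exponent with which `a` is conjugated by `c` under `φ`. -/
noncomputable def Df (c a : V) (φ : MulAut (Raag G)) : ℤ := Mf G c (gm φ⁻¹ a) (φ (gen G a))

lemma not_adj_of_star {c a : V} (h : a ∉ star G c) : ¬ G.Adj c a := fun h1 =>
  h (mem_star.mpr (Or.inr h1))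

lemma Kf_inv_row {φ : MulAut (Raag G)} (h : φ ∈ H3 G) {c a : V} (ha : a ∉ star G c) :
    Kf G c (gm φ⁻¹ a) (φ (gen G a)) = 1 := by
  rw [Kf_row ((H3 G).inv_mem h) ha]
  simp

lemma Mf_good {φ : MulAut (Raag G)} (h : φ ∈ H3 G) {c a : V} (ha : Good G c a) (s : V → ℤ) :
    Mf G c s (φ (gen G a)) = Kf G c s (φ (gen G a)) * Df c a φ := by
  obtain ⟨e, hae, he⟩ := good_nbr ha
  have hc := app_comm φ hae
  have hP := mf_good h ha.2
  have hQ := mf_good h he.2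
  let p := gm φ e a
  let q := gm φ a a
  let r : V → ℤ := p • del a + (-q) • del e
  have hKP : Kf G c r (φ (gen G a)) = 0 := by
    simp only [r, Kf_add, Kf_smul, Kf_del _ _ (not_adj_of_star ha.1),
      Kf_del _ _ (not_adj_of_star he.1)]
    change p * gm φ a a + -q * gm φ e a = 0
    simp only [p, q]; ring
  have hKQ : Kf G c r (φ (gen G e)) ≠ 0 := by
    simp only [r, Kf_add, Kf_smul, Kf_del _ _ (not_adj_of_star ha.1),
      Kf_del _ _ (not_adj_of_star he.1)]
    change p * gm φ a e + -q * gm φ e e ≠ 0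
    intro h0
    have := congrArg (Int.cast : ℤ → ZMod 3) h0
    simp only [p, q] at this
    push_cast at this
    rw [H3_diag h, H3_diag h, H3_off h hae.ne] at this
    exact absurd this (by simp)
  have hMP : Mf G c r (φ (gen G a)) = 0 := by
    have := com2 hc c r hP hQ
    rw [hKP, zero_mul] at this
    exact (mul_eq_zero.mp this.symm).resolve_left hKQ
  have key : ∀ s, Kf G c s (φ (gen G a)) * Mf G c r (φ (gen G e))
      = Kf G c r (φ (gen G e)) * Mf G c s (φ (gen G a)) := by
    intro s
    have := com3 hc c r s hP hQ
    rw [hKP, hMP] at this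
    linarith
  have k1 := key s
  have k2 := key (gm φ⁻¹ a)
  rw [Kf_inv_row h ha.1, one_mul] at k2
  apply mul_left_cancel₀ hKQ
  rw [← k1, k2]
  simp only [Df]; ring

lemma Df_adj {φ : MulAut (Raag G)} (h : φ ∈ H3 G) {c a e : V} (hae : G.Adj a e)
    (ha : a ∉ star G c) (he : e ∉ star G c) : Df c a φ = Df c e φ := by
  have ga := good_of_adj hae ha he
  have ge := good_of_adj hae.symm he ha
  have h2 := com2 (app_comm φ hae) c (del a + del e) (mf_good h ga.2) (mf_good h ge.2)
  rw [Mf_good h ga, Mf_good h ge] at h2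
  have hP : Kf G c (del a + del e) (φ (gen G a)) ≠ 0 := by
    rw [Kf_add, Kf_del _ _ (not_adj_of_star ha), Kf_del _ _ (not_adj_of_star he)]
    change gm φ a a + gm φ e a ≠ 0
    intro h0
    have := congrArg (Int.cast : ℤ → ZMod 3) h0
    push_cast at this
    rw [H3_diag h, H3_off h hae.ne'] at this
    exact absurd this (by simp)
  have hQ : Kf G c (del a + del e) (φ (gen G e)) ≠ 0 := by
    rw [Kf_add, Kf_del _ _ (not_adj_of_star ha), Kf_del _ _ (not_adj_of_star he)]
    change gm φ a e + gm φ e e ≠ 0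
    intro h0
    have := congrArg (Int.cast : ℤ → ZMod 3) h0
    push_cast at this
    rw [H3_diag h, H3_off h hae.ne] at this
    exact absurd this (by simp)
  apply mul_left_cancel₀ (mul_ne_zero hP hQ)
  linear_combination -h2

/-- Vertices dominating a good vertex. -/
lemma Mf_above {φ : MulAut (Raag G)} (h : φ ∈ H3 G) {x a w : V} (ha : Good G x a)
    (haw : Dom G a w) :
    Mf G x (del a) (φ (gen G w)) = gm φ a w * Df x a φ := by
  have hwx : ¬ Dom G w x := fun h1 => ha.2 (dom_trans haw h1)
  obtain ⟨e, hae, he⟩ := good_nbr ha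
  by_cases hw : w ∈ star G x
  · have hxw : G.Adj x w := by
      rcases mem_star.mp hw with rfl | h1
      · exact absurd haw ha.2
      · exact h1
    have hwe : G.Adj w e := by
      rcases mem_star.mp (haw hae) with rfl | h1
      · exact absurd hw he.1
      · exact h1
    have hrow : gm φ a w = 0 := by
      by_contra h1
      exact not_adj_of_row h ha.1 h1 hxw
    rw [hrow, zero_mul]
    have hK : ∀ s, Kf G x s (φ (gen G w)) = 0 := by
      intro s
      rw [Kf_eq]
      refine Finset.sum_eq_zero fun b _ => ?_
      split_ifs with h1
      · simp
      · by_cases h2 : gm φ b w = 0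
        · change s b * gm φ b w = 0
          rw [h2, mul_zero]
        · exfalso
          have h3 := gm_dom h h2
          rcases mem_star.mp (h3 hxw.symm) with h4 | h4
          · exact hwx (h4 ▸ h3)
          · exact h1 h4.symm
    have hKe : Kf G x (del e) (φ (gen G e)) ≠ 0 := by
      rw [Kf_del _ _ (not_adj_of_star he.1)]
      exact H3_diag_ne h e
    have c2 := com2 (app_comm φ hwe) x (del e) (mf_good h hwx) (mf_good h he.2)
    rw [hK, zero_mul] at c2
    have hMe := (mul_eq_zero.mp c2.symm).resolve_left hKe
    have c3 := com3 (app_comm φ hwe) x (del e) (del a) (mf_good h hwx) (mf_good h he.2)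
    rw [hK, hK, hMe] at c3
    simp only [zero_mul, mul_zero, add_zero] at c3
    exact (mul_eq_zero.mp c3.symm).resolve_left hKe
  · have gw : Good G x w := ⟨hw, hwx⟩
    rw [Mf_good h gw, Kf_del _ _ (not_adj_of_star ha.1)]
    change gm φ a w * _ = _
    congr 1
    rcases mem_star.mp (haw hae) with h1 | h1
    · rw [← h1]
      exact Df_adj h hae.symm he.1 ha.1
    · rw [Df_adj h h1 hw he.1, Df_adj h hae ha.1 he.1]

lemma expand {φ : MulAut (Raag G)} (h : φ ∈ H3 G) {x a : V} (ha : Good G x a) (y : Raag G) :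
    Mf G x (del a) (φ y) = ∑ w, mf G w y * Mf G x (del a) (φ (gen G w))
      + ∑ c, gm φ x c * Mf G c (gm φ a) y := by
  have hcross : ∀ y z, ∑ c, gm φ x c * (Kf G c (gm φ a) y * mf G c z)
      = mf G a (φ y) * mf G x (φ z) := by
    intro y z
    rw [mf_app φ x z, Finset.mul_sum]
    refine Finset.sum_congr rfl fun c _ => ?_
    by_cases h0 : gm φ x c = 0
    · simp [h0]
    · rw [Kf_row h (good_mono (gm_dom h h0) ha).1]; ring
  induction y using raag_ind with
  | h1 => simp
  | hg v => simp
  | hm y z hy hz =>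
    simp only [map_mul, Mf_mul, mf_mul, hy, hz, add_mul, mul_add, Finset.sum_add_distrib, hcross]
    rw [Kf_del _ _ (not_adj_of_star ha.1)]
    ring
  | hi y hy =>
    simp only [map_inv, Mf_inv, mf_inv, hy, neg_mul, mul_neg, mul_add, Finset.sum_add_distrib,
      hcross, Finset.sum_neg_distrib]
    rw [Kf_del _ _ (not_adj_of_star ha.1)]
    ring

lemma Df_mul {φ ψ : MulAut (Raag G)} (h : φ ∈ H3 G) (h' : ψ ∈ H3 G) {x a : V} (ha : Good G x a)
    (hx : ∀ y, EquivDom G y x → y = x) :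
    Df x a (φ * ψ) = Df x a φ + Df x a ψ
      + ∑ c ∈ Finset.univ.erase x, gm φ x c * Df c a ψ := by
  have hh := (H3 G).mul_mem h h'
  have e0 := Mf_good hh ha (del a)
  rw [Kf_del _ _ (not_adj_of_star ha.1)] at e0
  change _ = gm (φ * ψ) a a * _ at e0
  have e1 := expand h ha (ψ (gen G a))
  change Mf G x (del a) ((φ * ψ) (gen G a)) = _ at e1
  have s1 : ∑ w, mf G w (ψ (gen G a)) * Mf G x (del a) (φ (gen G w))
      = gm (φ * ψ) a a * Df x a φ := by
    rw [gm_mul, Matrix.mul_apply, Finset.sum_mul]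
    refine Finset.sum_congr rfl fun w _ => ?_
    change gm ψ w a * _ = _
    by_cases h0 : gm ψ w a = 0
    · simp [h0]
    · rw [Mf_above h ha (gm_dom h' h0)]; ring
  have s2 : ∑ c, gm φ x c * Mf G c (gm φ a) (ψ (gen G a))
      = gm (φ * ψ) a a * ∑ c, gm φ x c * Df c a ψ := by
    rw [Finset.mul_sum]
    refine Finset.sum_congr rfl fun c _ => ?_
    by_cases h0 : gm φ x c = 0
    · simp [h0]
    · have gc := good_mono (gm_dom h h0) ha
      rw [Mf_good h' gc, Kf_row h gc.1]
      change _ * (gm (φ * ψ) a a * _) = _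
      ring
  have s3 : ∑ c, gm φ x c * Df c a ψ
      = Df x a ψ + ∑ c ∈ Finset.univ.erase x, gm φ x c * Df c a ψ := by
    rw [← Finset.add_sum_erase _ _ (Finset.mem_univ x), gm_self h x hx, one_mul]
  rw [s1, s2, s3, e0, ← mul_add] at e1
  have := mul_left_cancel₀ (H3_diag_ne hh a) e1
  rw [this]; ring

/-! Partial conjugations. -/

/-- `φ` conjugates each vertex `v` by `x ^ n v`. -/
def IsPC (x : V) (n : V → ℤ) (φ : MulAut (Raag G)) : Prop :=
  ∀ v, φ (gen G v) = (gen G x) ^ (- n v) * gen G v * (gen G x) ^ (n v)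

/-- `n` is locally constant outside the star of `x`. -/
def LC (G : SimpleGraph V) (x : V) (n : V → ℤ) : Prop :=
  ∀ u v, G.Adj u v → u ∉ star G x → v ∉ star G x → n u = n v

lemma comm_star {x v : V} (h : v ∈ star G x) : Commute (gen G v) (gen G x) := by
  rcases mem_star.mp h with rfl | h
  · exact Commute.refl _
  · exact (gen_comm h).symm

lemma conj_star {x v : V} (h : v ∈ star G x) (k : ℤ) :
    (gen G x) ^ (-k) * gen G v * (gen G x) ^ k = gen G v := by
  rw [mul_assoc, ((comm_star h).zpow_right k).eq, ← mul_assoc, ← zpow_add]; simp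

lemma isPC_congr {x : V} {n n' : V → ℤ} (h : ∀ v, v ∉ star G x → n v = n' v)
    {φ : MulAut (Raag G)} (hφ : IsPC x n φ) : IsPC x n' φ := by
  intro v
  by_cases hv : v ∈ star G x
  · rw [hφ v, conj_star hv, conj_star hv]
  · rw [hφ v, h v hv]

lemma isPC_x {x : V} {n : V → ℤ} {φ : MulAut (Raag G)} (hφ : IsPC x n φ) :
    φ (gen G x) = gen G x := by
  rw [hφ x, conj_star (mem_star.mpr (Or.inl rfl))]

lemma isPC_mul {x : V} {n n' : V → ℤ} {φ φ' : MulAut (Raag G)} (hφ : IsPC x n φ)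
    (hφ' : IsPC x n' φ') : IsPC x (n + n') (φ * φ') := by
  intro v
  rw [MulAut.mul_apply, hφ' v, map_mul, map_mul, map_zpow, map_zpow, isPC_x hφ, hφ v, Pi.add_apply]
  have e1 : -(n v + n' v) = -n' v + -n v := by ring
  rw [e1, zpow_add, zpow_add]
  simp only [mul_assoc]

lemma isPC_one {x : V} : IsPC x 0 (1 : MulAut (Raag G)) := by
  intro v; simp

lemma isPC_unique {x : V} {n : V → ℤ} {φ φ' : MulAut (Raag G)} (hφ : IsPC x n φ)
    (hφ' : IsPC x n φ') : φ = φ' := by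
  ext y
  induction y using raag_ind with
  | h1 => simp
  | hg v => rw [hφ v, hφ' v]
  | hm y z hy hz => simp [hy, hz]
  | hi y hy => simp [hy]

noncomputable def pcHom (x : V) (n : V → ℤ) (hn : LC G x n) : Raag G →* Raag G :=
  liftR (fun v => (gen G x) ^ (- n v) * gen G v * (gen G x) ^ (n v)) (by
    have key : ∀ (k : ℤ) (u v : V), G.Adj u v → Commute
        ((gen G x) ^ (- k) * gen G u * (gen G x) ^ k)
        ((gen G x) ^ (- k) * gen G v * (gen G x) ^ k) := by
      intro k u v h
      have := (gen_comm h).map (MulAut.conj ((gen G x) ^ (-k)))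
      simp only [MulAut.conj_apply] at this
      rw [← zpow_neg, neg_neg] at this
      exact this
    intro u v h
    by_cases hu : u ∈ star G x
    · have := key (n v) u v h
      rw [conj_star hu] at this
      rw [conj_star hu]; exact this
    · by_cases hv : v ∈ star G x
      · have := key (n u) u v h
        rw [conj_star hv] at this
        rw [conj_star hv]; exact this
      · have := key (n u) u v h
        rw [← hn u v h hu hv]; exact this)

lemma pcHom_gen (x : V) (n : V → ℤ) (hn : LC G x n) (v : V) :
    pcHom x n hn (gen G v) = (gen G x) ^ (- n v) * gen G v * (gen G x) ^ (n v) := liftR_gen _ _ _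

lemma LC.neg {x : V} {n : V → ℤ} (hn : LC G x n) : LC G x (-n) := by
  intro u v h hu hv
  simp [hn u v h hu hv]

lemma pcHom_inv (x : V) (n : V → ℤ) (hn : LC G x n) (n' : V → ℤ) (hn' : LC G x n')
    (hnn : ∀ v, n' v = - n v) (y : Raag G) :
    pcHom x n hn (pcHom x n' hn' y) = y := by
  induction y using raag_ind with
  | h1 => simp
  | hg v =>
    have hx : pcHom x n hn (gen G x) = gen G x := by
      rw [pcHom_gen, conj_star (mem_star.mpr (Or.inl rfl))]
    rw [pcHom_gen, map_mul, map_mul, map_zpow, map_zpow, hx, pcHom_gen, hnn]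
    simp only [neg_neg, mul_assoc, ← zpow_add]
    rw [← mul_assoc, ← zpow_add]
    simp
  | hm y z hy hz => simp [hy, hz]
  | hi y hy => simp [hy]

lemma exists_isPC (x : V) (n : V → ℤ) (hn : LC G x n) : ∃ φ : MulAut (Raag G), IsPC x n φ := by
  refine ⟨MonoidHom.toMulEquiv (pcHom x n hn) (pcHom x (-n) hn.neg) ?_ ?_, ?_⟩
  · refine MonoidHom.ext fun y => ?_
    exact (pcHom_inv x (-n) hn.neg n hn (by simp) _)
  · refine MonoidHom.ext fun y => ?_
    exact (pcHom_inv x n hn (-n) hn.neg (by simp) _)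
  · intro v
    exact pcHom_gen x n hn v

/-- Indicator function. -/
noncomputable def ind (C : Set V) : V → ℤ := fun v => if v ∈ C then 1 else 0

lemma isPartialConj_iff {x : V} {C : Set V} {φ : MulAut (Raag G)} :
    IsPartialConj G x C φ ↔ IsPC x (ind C) φ := by
  constructor
  · rintro ⟨h1, h2⟩ v
    by_cases hv : v ∈ C
    · simp [ind, hv, h1 v hv]
    · simp [ind, hv, h2 v hv]
  · intro h
    constructor
    · intro v hv
      simpa [ind, hv] using h v
    · intro v hv
      simpa [ind, hv] using h v

lemma isPC_inv {x : V} {n : V → ℤ} {φ : MulAut (Raag G)} (hφ : IsPC x n φ) :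
    IsPC x (-n) φ⁻¹ := by
  intro v
  have hx : φ⁻¹ (gen G x) = gen G x := by
    rw [MulAut.inv_apply, MulEquiv.symm_apply_eq, isPC_x hφ]
  rw [MulAut.inv_apply, MulEquiv.symm_apply_eq, map_mul, map_mul, map_zpow, map_zpow, isPC_x hφ,
    hφ v]
  simp only [Pi.neg_apply, neg_neg, mul_assoc, ← zpow_add]
  rw [← mul_assoc, ← zpow_add]
  simp

lemma isPC_zpow {x : V} {n : V → ℤ} {φ : MulAut (Raag G)} (hφ : IsPC x n φ) (k : ℤ) :
    IsPC x (k • n) (φ ^ k) := by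
  induction k using Int.induction_on with
  | zero => simpa using isPC_one
  | succ i ih => rw [add_smul, one_smul, zpow_add, zpow_one]; exact isPC_mul ih hφ
  | pred i ih =>
    rw [sub_smul, one_smul, zpow_sub, zpow_one, sub_eq_add_neg]; exact isPC_mul ih (isPC_inv hφ)

lemma isPC_inner (x : V) : IsPC x (fun _ => 1) (MulAut.conj (gen G x)⁻¹) := by
  intro v
  simp [MulAut.conj_apply]

/-! Components. -/

lemma isCC_closed {S C : Set V} (hC : IsCC G S C) {u v : V} (h : G.Adj u v) (hu : u ∈ C)
    (hv : v ∈ S) : v ∈ C := by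
  obtain ⟨t, rfl⟩ := hC
  obtain ⟨hu', hr⟩ := hu
  refine ⟨hv, ?_⟩
  have hadj : (G.induce S).Adj ⟨v, hv⟩ ⟨u, hu'⟩ := h.symm
  exact hadj.reachable.trans hr

lemma isCC_sub {S C : Set V} (hC : IsCC G S C) {u : V} (hu : u ∈ C) : u ∈ S := by
  obtain ⟨t, rfl⟩ := hC
  exact hu.1

lemma ind_LC {c x : V} (hc : Dom G c x) {D : Set V} (hD : IsCC G ((star G c)ᶜ) D) :
    LC G x (ind D) := by
  have key : ∀ u v, G.Adj u v → u ∉ star G x → v ∉ star G x → u ∈ D → v ∈ D := by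
    intro u v h hu hv huD
    refine isCC_closed hD h huD ?_
    intro hvc
    rcases mem_star.mp hvc with rfl | h1
    · exact isCC_sub hD huD (mem_star.mpr (Or.inr h.symm))
    · exact hv (hc h1)
  intro u v h hu hv
  have : u ∈ D ↔ v ∈ D := ⟨key u v h hu hv, key v u h.symm hv hu⟩
  simp [ind, this]

/-- Generators of the lattice of functions obtained from dominated components. -/
def Tset (G : SimpleGraph V) (x : V) : Set (V → ℤ) :=
  {n | ∃ c D, Dom G c x ∧ c ≠ x ∧ IsCC G ((star G c)ᶜ) D ∧ n = ind (D \ star G x)} ∪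
    {ind ((star G x)ᶜ)}

lemma virt_of_mem {x : V} (hx : ∀ y, EquivDom G y x → y = x) {C : Set V}
    (hC : IsCC G ((star G x)ᶜ) C) {k : ℤ} (hk : k ≠ 0)
    (hmem : k • ind C ∈ Submodule.span ℤ (Tset G x)) : VirtObtNE G x C := by
  let U : Set (Out (Raag G)) := {o | ∃ (y : V) (D : Set V) (ψ : MulAut (Raag G)),
    (Dom G y x ∧ ¬ EquivDom G y x) ∧ IsCC G ((star G y)ᶜ) D ∧ IsPartialConj G x D ψ ∧
      o = toOut _ ψ}
  have key : ∀ n ∈ Submodule.span ℤ (Tset G x), ∃ φ : MulAut (Raag G), IsPC x n φ ∧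
      toOut _ φ ∈ Subgroup.closure U := by
    intro n hn
    induction hn using Submodule.span_induction with
    | mem n hn =>
      rcases hn with ⟨c, D, hc, hcx, hD, rfl⟩ | rfl
      · obtain ⟨ψ, hψ⟩ := exists_isPC x (ind D) (ind_LC hc hD)
        refine ⟨ψ, isPC_congr (fun v hv => ?_) hψ, Subgroup.subset_closure
          ⟨c, D, ψ, ⟨hc, fun h => hcx (hx c h)⟩, hD, isPartialConj_iff.mpr hψ, rfl⟩⟩
        simp [ind, hv]
      · refine ⟨MulAut.conj (gen G x)⁻¹, isPC_congr (fun v hv => ?_) (isPC_inner x), ?_⟩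
        · simp [ind, hv]
        · have : toOut (Raag G) (MulAut.conj (gen G x)⁻¹) = 1 :=
            (QuotientGroup.eq_one_iff _).mpr ⟨_, rfl⟩
          rw [this]
          exact Subgroup.one_mem _
    | zero => exact ⟨1, isPC_one, by simp [Subgroup.one_mem]⟩
    | add n n' _ _ h1 h2 =>
      obtain ⟨φ, h1, h1'⟩ := h1
      obtain ⟨φ', h2, h2'⟩ := h2
      exact ⟨φ * φ', isPC_mul h1 h2, by rw [map_mul]; exact Subgroup.mul_mem _ h1' h2'⟩
    | smul a n _ h1 =>
      obtain ⟨φ, h1, h1'⟩ := h1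
      exact ⟨φ ^ a, isPC_zpow h1 a, by rw [map_zpow]; exact Subgroup.zpow_mem _ h1' a⟩
  obtain ⟨φ, hφ⟩ := exists_isPC x (ind C) (ind_LC (fun t ht => mem_star.mpr (Or.inr ht)) hC)
  obtain ⟨φ', hφ', hcl⟩ := key _ hmem
  rw [isPC_unique hφ' (isPC_zpow hφ k), map_zpow] at hcl
  rw [← Subgroup.mem_toSubmonoid, Subgroup.closure_toSubmonoid] at hcl
  obtain ⟨l, hl, hprod⟩ := Submonoid.exists_list_of_mem_closure hcl
  have hch : ∀ o ∈ l, ∃ (y : V) (D : Set V) (ε : ℤ) (ψ : MulAut (Raag G)),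
      (Dom G y x ∧ ¬ EquivDom G y x) ∧ IsCC G ((star G y)ᶜ) D ∧ (ε = 1 ∨ ε = -1) ∧
      IsPartialConj G x D ψ ∧ o = toOut _ ψ ^ ε := by
    intro o ho
    rcases hl o ho with ⟨y, D, ψ, h1, h2, h3, h4⟩ | ⟨y, D, ψ, h1, h2, h3, h4⟩
    · exact ⟨y, D, 1, ψ, h1, h2, Or.inl rfl, h3, by simpa using h4⟩
    · exact ⟨y, D, -1, ψ, h1, h2, Or.inr rfl, h3, by rw [zpow_neg_one, ← h4, inv_inv]⟩
  have : Nonempty V := ⟨x⟩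
  choose! fy fD fε fψ hf1 hf2 hf3 hf4 hf5 using hch
  refine ⟨k, hk, l.length, fun i => fy l[i], fun i => fD l[i], fun i => fε l[i], φ,
    fun i => fψ l[i], fun i => hf1 _ (List.getElem_mem _), fun i => hf2 _ (List.getElem_mem _),
    fun i => hf3 _ (List.getElem_mem _), isPartialConj_iff.mpr hφ,
    fun i => hf4 _ (List.getElem_mem _), ?_⟩
  rw [← hprod]
  congr 1
  apply List.ext_getElem
  · simp
  · intro i h1 h2
    simp only [List.getElem_ofFn]
    exact hf5 _ (List.getElem_mem _)

/-- Functions that are locally constant off a dominated star lie in the span. -/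
lemma mem_span_of_LC {c x : V} (hc : Dom G c x) (hcx : c ≠ x) (n : V → ℤ) (hn : LC G c n) :
    (fun v => if v ∉ star G c ∧ v ∉ star G x then n v else 0) ∈ Submodule.span ℤ (Tset G x) := by
  let S : Set V := (star G c)ᶜ
  let Gi := G.induce S
  have hconst : ∀ a b : S, Gi.Reachable a b → n a = n b := by
    rintro a b ⟨p⟩
    induction p with
    | nil => rfl
    | @cons u v w h p ih => rw [← ih]; exact hn _ _ h u.2 v.2
  let comp : Gi.ConnectedComponent → Set V := fun E => {w | ∃ h : w ∈ S, Gi.Reachable ⟨w, h⟩ E.out}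
  have hcomp : ∀ E, IsCC G S (comp E) := fun E => ⟨E.out, rfl⟩
  have heq : (fun v => if v ∉ star G c ∧ v ∉ star G x then n v else 0)
      = ∑ E : Gi.ConnectedComponent, n E.out • ind (comp E \ star G x) := by
    funext v
    rw [Finset.sum_apply]
    by_cases hv : v ∉ star G c ∧ v ∉ star G x
    · rw [if_pos hv]
      have hvS : v ∈ S := hv.1
      have hr : Gi.Reachable ⟨v, hvS⟩ (Gi.connectedComponentMk ⟨v, hvS⟩).out :=
        (SimpleGraph.ConnectedComponent.exact (Quot.out_eq _)).symm
      rw [Finset.sum_eq_single (Gi.connectedComponentMk ⟨v, hvS⟩)]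
      · have hm : v ∈ comp (Gi.connectedComponentMk ⟨v, hvS⟩) := ⟨hvS, hr⟩
        simp [ind, hm, hv.2, ← hconst _ _ hr]
      · intro E _ hE
        have hm : v ∉ comp E := by
          rintro ⟨h1, h2⟩
          apply hE
          rw [← Quot.out_eq E]
          exact SimpleGraph.ConnectedComponent.sound h2.symm
        simp [ind, hm]
      · simp
    · rw [if_neg hv]
      symm
      refine Finset.sum_eq_zero fun E _ => ?_
      have hm : v ∉ comp E \ star G x := by
        rintro ⟨⟨h1, h2⟩, h3⟩
        exact hv ⟨h1, h3⟩
      simp [ind, hm]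
  rw [heq]
  refine Submodule.sum_mem _ fun E _ => Submodule.smul_mem _ _ (Submodule.subset_span ?_)
  exact Or.inl ⟨c, comp E, hc, hcx, hcomp E, rfl⟩

lemma exists_dual {M : Type} [AddCommGroup M] [Module.Finite ℤ M] (S : Submodule ℤ M)
    (v : M) (hv : ∀ k : ℤ, k ≠ 0 → k • v ∉ S) :
    ∃ f : M →ₗ[ℤ] ℤ, (∀ s ∈ S, f s = 0) ∧ f v ≠ 0 := by
  let Q := M ⧸ S
  let T := Q ⧸ Submodule.torsion ℤ Q
  let q : M →ₗ[ℤ] T := (Submodule.mkQ _).comp (Submodule.mkQ S)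
  have hq : q v ≠ 0 := by
    intro h0
    have h1 : (Submodule.mkQ S v) ∈ Submodule.torsion ℤ Q := (Submodule.Quotient.mk_eq_zero _).mp h0
    rw [Submodule.mem_torsion_iff] at h1
    obtain ⟨a, ha⟩ := h1
    apply hv a.1 (nonZeroDivisors.ne_zero a.2)
    rw [← Submodule.Quotient.mk_eq_zero]
    exact ha
  have : Module.Free ℤ T := inferInstance
  have : ∃ f : Module.Dual ℤ T, f (q v) ≠ 0 := by
    by_contra hcon
    push Not at hcon
    exact hq ((Module.forall_dual_apply_eq_zero_iff ℤ (q v)).mp hcon)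
  obtain ⟨f, hf⟩ := this
  refine ⟨f.comp q, fun s hs => ?_, hf⟩
  have : q s = 0 := by
    change Submodule.mkQ _ (Submodule.mkQ S s) = 0
    rw [(Submodule.Quotient.mk_eq_zero S).mpr hs |> (show Submodule.mkQ S s = 0 from ·), map_zero]
  simp [this]

lemma surj_of_hom {H : Type*} [Group H] (F : H →* Multiplicative ℤ) (h : H) (hF : F h ≠ 1) :
    ∃ f : H →* Multiplicative ℤ, Function.Surjective f := by
  let R : AddSubgroup ℤ := AddSubgroup.map (AddMonoidHom.id ℤ) (MonoidHom.toAdditiveLeft F).range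
  obtain ⟨d, hd⟩ := Int.subgroup_cyclic R
  have hR : ∀ z : ℤ, z ∈ R ↔ ∃ h, (F h).toAdd = z := by
    intro z
    constructor
    · rintro ⟨_, ⟨g, rfl⟩, rfl⟩
      exact ⟨g.toMul, rfl⟩
    · rintro ⟨g, rfl⟩
      exact ⟨_, ⟨Additive.ofMul g, rfl⟩, rfl⟩
  have hdvd : ∀ g, d ∣ (F g).toAdd := by
    intro g
    have h1 := (hR _).mpr ⟨g, rfl⟩
    rw [hd, AddSubgroup.mem_closure_singleton] at h1
    obtain ⟨n, hn⟩ := h1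
    exact ⟨n, by rw [← hn, smul_eq_mul, mul_comm]⟩
  obtain ⟨g0, hg0⟩ := (hR d).mp (by rw [hd]; exact AddSubgroup.subset_closure rfl)
  have hd0 : d ≠ 0 := by
    rintro rfl
    apply hF
    have := hdvd h
    rw [zero_dvd_iff] at this
    exact this
  let f : H →* Multiplicative ℤ :=
    { toFun := fun g => Multiplicative.ofAdd ((F g).toAdd / d)
      map_one' := by simp
      map_mul' := by
        intro a b
        rw [← ofAdd_add, map_mul, toAdd_mul, Int.add_ediv_of_dvd_left (hdvd a)] }
  refine ⟨f, fun z => ⟨g0 ^ z.toAdd, ?_⟩⟩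
  rw [map_zpow]
  have : f g0 = Multiplicative.ofAdd 1 := by
    change Multiplicative.ofAdd ((F g0).toAdd / d) = _
    rw [hg0, Int.ediv_self hd0]
  rw [this, ← ofAdd_zsmul]
  simp

lemma main_aux {x : V} (hx : ∀ y, EquivDom G y x → y = x) {C : Set V}
    (hC : IsCC G ((star G x)ᶜ) C) (hnv : ¬ VirtObtNE G x C) :
    ∃ f : H3 G →* Multiplicative ℤ, Function.Surjective f := by
  obtain ⟨L, hL0, hLC⟩ := exists_dual (Submodule.span ℤ (Tset G x)) (ind C)
    (fun k hk hmem => hnv (virt_of_mem hx hC hk hmem))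
  let lam : V → ℤ := fun a => L (del a)
  have hL : ∀ n : V → ℤ, L n = ∑ a, lam a * n a := by
    intro n
    have : n = ∑ a, n a • del a := by
      funext v
      simp [Finset.sum_apply, del]
    conv_lhs => rw [this]
    rw [map_sum]
    refine Finset.sum_congr rfl fun a _ => ?_
    rw [map_smul, smul_eq_mul, mul_comm]
  -- `lam` vanishes on the vertices outside the star which are dominated by `x`
  have hlam : ∀ a, a ∉ star G x → Dom G a x → lam a = 0 := by
    intro a ha hd
    have hax : a ≠ x := fun h => ha (mem_star.mpr (Or.inl h))
    have h1 := mem_span_of_LC hd hax (fun _ => 1) (fun _ _ _ _ _ => rfl)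
    have h2 : ind ((star G x)ᶜ) ∈ Submodule.span ℤ (Tset G x) :=
      Submodule.subset_span (Or.inr rfl)
    have h3 : del a = ind ((star G x)ᶜ)
        - (fun v => if v ∉ star G a ∧ v ∉ star G x then (1 : ℤ) else 0) := by
      funext v
      by_cases hv : v = a
      · subst hv
        have : v ∈ star G v := mem_star.mpr (Or.inl rfl)
        simp [del, ind, ha, this]
      · by_cases hvx : v ∈ star G x
        · simp [del, ind, hv, hvx]
        · have : v ∉ star G a := by
            intro h4
            rcases mem_star.mp h4 with h5 | h5
            · exact hv h5
            · exact hvx (hd h5)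
          simp [del, ind, hv, hvx, this]
    change L (del a) = 0
    rw [h3]
    exact hL0 _ (Submodule.sub_mem _ h2 h1)
  let F0 : MulAut (Raag G) → ℤ := fun φ => ∑ a ∈ Finset.univ.filter (Good G x), lam a * Df x a φ
  have hvan : ∀ ψ ∈ H3 G, ∀ c, Dom G c x → c ≠ x →
      ∑ a ∈ Finset.univ.filter (Good G x), lam a * Df c a ψ = 0 := by
    intro ψ hψ c hc hcx
    have h1 := hL0 _ (mem_span_of_LC hc hcx (fun a => Df c a ψ)
      (fun u v h hu hv => Df_adj hψ h hu hv))
    rw [hL] at h1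
    rw [← h1, Finset.sum_filter]
    refine Finset.sum_congr rfl fun a _ => ?_
    by_cases ha : a ∈ star G x
    · rw [if_neg (fun h => h.1 ha), if_neg (fun h => h.2 ha), mul_zero]
    · by_cases hd : Dom G a x
      · rw [hlam a ha hd]; simp
      · have g : Good G x a := ⟨ha, hd⟩
        rw [if_pos g, if_pos ⟨(good_mono hc g).1, ha⟩]
  have hF0 : ∀ φ ∈ H3 G, ∀ ψ ∈ H3 G, F0 (φ * ψ) = F0 φ + F0 ψ := by
    intro φ hφ ψ hψ
    have h1 : F0 (φ * ψ) = F0 φ + F0 ψ + ∑ c ∈ Finset.univ.erase x,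
        gm φ x c * ∑ a ∈ Finset.univ.filter (Good G x), lam a * Df c a ψ := by
      simp only [F0, Finset.mul_sum]
      rw [Finset.sum_comm, ← Finset.sum_add_distrib, ← Finset.sum_add_distrib]
      refine Finset.sum_congr rfl fun a ha => ?_
      rw [Df_mul hφ hψ (Finset.mem_filter.mp ha).2 hx, mul_add, mul_add, Finset.mul_sum]
      congr 1
      refine Finset.sum_congr rfl fun c _ => ?_
      ring
    rw [h1, Finset.sum_eq_zero, add_zero]
    intro c hc
    by_cases h0 : gm φ x c = 0
    · rw [h0, zero_mul]
    · rw [hvan ψ hψ c (gm_dom hφ h0) (Finset.ne_of_mem_erase hc), mul_zero]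
  let F : H3 G →* Multiplicative ℤ := MonoidHom.mk' (fun φ => Multiplicative.ofAdd (F0 φ.1)) (by
    intro φ ψ
    rw [← ofAdd_add, ← hF0 _ φ.2 _ ψ.2]
    rfl)
  obtain ⟨π, hπ⟩ := exists_isPC x (ind C) (ind_LC (fun t ht => mem_star.mpr (Or.inr ht)) hC)
  have hgm : ∀ (n : V → ℤ) (φ : MulAut (Raag G)), IsPC x n φ → gm φ = 1 := by
    intro n φ h
    ext w v
    have hz : ∀ k : ℤ, mf G w ((gen G x) ^ (-k)) + mf G w ((gen G x) ^ k) = 0 := by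
      intro k
      rw [← mf_mul, ← zpow_add]; simp
    change mf G w (φ (gen G v)) = _
    rw [h v, mf_mul, mf_mul, mf_gen, Matrix.one_apply]
    have := hz (n v)
    simp only [eq_comm (a := v)]
    linarith
  have hπ3 : π ∈ H3 G := mem_H3.mpr (by rw [hgm _ _ hπ, map_one])
  refine surj_of_hom F ⟨π, hπ3⟩ ?_
  intro h0
  have h1 : F0 π = 0 := h0
  apply hLC
  rw [hL, ← h1]
  simp only [F0]
  rw [Finset.sum_filter]
  refine Finset.sum_congr rfl fun a _ => ?_
  by_cases ha : a ∈ star G x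
  · rw [if_neg (fun h => h.1 ha)]
    have : a ∉ C := fun h => isCC_sub hC h ha
    simp [ind, this]
  · by_cases hd : Dom G a x
    · rw [hlam a ha hd]; simp
    · rw [if_pos ⟨ha, hd⟩]
      congr 1
      unfold Df
      rw [hgm _ _ (isPC_inv hπ), hπ a]
      have hax : a ≠ x := fun h => ha (mem_star.mpr (Or.inl h))
      have hadj := not_adj_of_star ha
      by_cases haC : a ∈ C
      · simp [ind, haC, hadj, hax]
      · simp [ind, haC]

end

end RaagProof

open RaagPaper in
/-- If `Γ` fails condition (A2'), then `Aut(A_Γ)` has a finite-index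
subgroup admitting a surjective homomorphism onto `ℤ`. -/
theorem statement10 {V : Type} [Fintype V] (G : SimpleGraph V)
    (h : ¬ CondA2' G) :
    ∃ H : Subgroup (MulAut (Raag G)), H.FiniteIndex ∧
      ∃ f : H →* Multiplicative ℤ, Function.Surjective f := by
  unfold CondA2' at h
  push Not at h
  obtain ⟨X, C, ⟨x0, hX⟩, -, hP, hsub⟩ := h
  unfold Principal NonPrincipal at hP
  push Not at hP
  obtain ⟨x, hxX, hC, hnv⟩ := hP
  have hx0 : EquivDom G x x0 := by rw [hX] at hxX; exact hxX
  refine ⟨RaagProof.H3 G, RaagProof.H3_finiteIndex, RaagProof.main_aux (x := x) ?_ hC hnv⟩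
  intro y hy
  refine hsub ?_ hxX
  rw [hX]
  exact ⟨RaagProof.dom_trans hy.1 hx0.1, RaagProof.dom_trans hx0.2 hy.2⟩
end
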